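/- Let k ≥ 8 and m ≥ 2 be integers and set α = 1 − 1/2^{k−5} + 1/(2^{k−5}·m). Then α ∈ S_k^1; that is, there exists a graph property L expressible by a first-order sentence of quantifier depth at most k such that, with p(n) = n^{−α}, the sequence P(G(n,p(n)) ⊨ L) does not converge to 0 and does not converge to 1. -/

import Mathlib

open Filter Topology FirstOrder

namespace RandomGraphSpectra

/-- The quantifier depth of a first-order (bounded) formula. -/
def qDepth {L : FirstOrder.Language} {α : Type*} :
    ∀ {n : ℕ}, L.BoundedFormula α n → ℕ
  | _, .falsum => 0
  | _, .equal _ _ => 0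
  | _, .rel _ _ => 0
  | _, .imp f g => max (qDepth f) (qDepth g)
  | _, .all f => qDepth f + 1

/-- A simple graph satisfies a first-order sentence in the language of graphs. -/
def GraphSat {V : Type*} (G : SimpleGraph V) (φ : FirstOrder.Language.graph.Sentence) : Prop :=
  @FirstOrder.Language.Sentence.Realize FirstOrder.Language.graph V G.structure φ

/-- The number of edges of a simple graph. -/
noncomputable def edgeCount {V : Type*} (G : SimpleGraph V) : ℕ := Nat.card G.edgeSet

/-- The probability that `G(n,p)` equals a fixed graph `G` on `{1,…,n}`. -/
noncomputable def weight (n : ℕ) (p : ℝ) (G : SimpleGraph (Fin n)) : ℝ :=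
  p ^ edgeCount G * (1 - p) ^ (n.choose 2 - edgeCount G)

open Classical in
/-- The probability that the Erdős–Rényi random graph `G(n,p)` satisfies a predicate `P`. -/
noncomputable def probPred (n : ℕ) (p : ℝ) (P : SimpleGraph (Fin n) → Prop) : ℝ :=
  ∑ᶠ G : SimpleGraph (Fin n), if P G then weight n p G else 0

/-- The probability that `G(n,p)` satisfies a first-order sentence. -/
noncomputable def probSat (n : ℕ) (p : ℝ) (φ : FirstOrder.Language.graph.Sentence) : ℝ :=
  probPred n p (fun G => GraphSat G φ)

open Classical in
/-- The probability that the pair of independent random graphs `G(n,p), G(m,q)`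
satisfies a predicate `P`. -/
noncomputable def probPred2 (n m : ℕ) (p q : ℝ)
    (P : SimpleGraph (Fin n) → SimpleGraph (Fin m) → Prop) : ℝ :=
  ∑ᶠ G : SimpleGraph (Fin n), ∑ᶠ H : SimpleGraph (Fin m),
    if P G H then weight n p G * weight m q H else 0

/-- The spectrum `S_k^1`: the set of `α ∈ (0,1)` such that for some first-order sentence `φ`
of quantifier depth at most `k`, with `p(n) = n^{-α}`, the probability that `G(n,p(n)) ⊨ φ`
does not tend to `0` and does not tend to `1`. -/
def S1 (k : ℕ) : Set ℝ :=
  {α | α ∈ Set.Ioo (0 : ℝ) 1 ∧ ∃ φ : FirstOrder.Language.graph.Sentence, qDepth φ ≤ k ∧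
    ¬(Tendsto (fun n : ℕ => probSat n ((n : ℝ) ^ (-α)) φ) atTop (nhds 0) ∨
      Tendsto (fun n : ℕ => probSat n ((n : ℝ) ^ (-α)) φ) atTop (nhds 1))}

/-- The spectrum `S_k^2`. -/
def S2 (k : ℕ) : Set ℝ :=
  {α | α ∈ Set.Ioo (0 : ℝ) 1 ∧ ∃ φ : FirstOrder.Language.graph.Sentence, qDepth φ ≤ k ∧
    ¬∃ δ : ℝ, (δ = 0 ∨ δ = 1) ∧ ∃ ε : ℝ, 0 < ε ∧ ∀ p : ℕ → ℝ,
      (∀ n : ℕ, 1 ≤ n → (n : ℝ) ^ (-α - ε) < p n ∧ p n < (n : ℝ) ^ (-α + ε)) →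
      Tendsto (fun n : ℕ => probSat n (p n) φ) atTop (nhds δ)}

/-- `G(n, p(n))` obeys the zero-one `k`-law. -/
def ZeroOneKLaw (k : ℕ) (p : ℕ → ℝ) : Prop :=
  ∀ φ : FirstOrder.Language.graph.Sentence, qDepth φ ≤ k →
    Tendsto (fun n : ℕ => probSat n (p n) φ) atTop (nhds 0) ∨
    Tendsto (fun n : ℕ => probSat n (p n) φ) atTop (nhds 1)

/-- The density `ρ(G) = e(G)/v(G)` of a graph. -/
noncomputable def density {V : Type*} (G : SimpleGraph V) : ℝ :=
  (Nat.card G.edgeSet : ℝ) / (Nat.card V : ℝ)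

/-- A graph is strictly balanced if every proper subgraph with at least one vertex has
strictly smaller density. -/
def StrictlyBalanced {V : Type*} (G : SimpleGraph V) : Prop :=
  ∀ H : G.Subgraph, H ≠ ⊤ → H.verts.Nonempty → density H.coe < density G

/-- `ρ^max(G)`: the maximum density of a subgraph of `G` with at least one vertex. -/
noncomputable def maxDensity {V : Type*} (G : SimpleGraph V) : ℝ :=
  sSup {x : ℝ | ∃ H : G.Subgraph, H.verts.Nonempty ∧ x = density H.coe}

/-- The relative density `ρ(K,H) = e(K,H)/v(K,H)` of a pair of nested subgraphs. -/
noncomputable def pairDensity {V : Type*} {G : SimpleGraph V} (K H : G.Subgraph) : ℝ :=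
  ((Nat.card K.edgeSet : ℝ) - (Nat.card H.edgeSet : ℝ)) /
    ((Nat.card K.verts : ℝ) - (Nat.card H.verts : ℝ))

/-- `ρ^max(G,H)` where the ambient graph `G` corresponds to the top subgraph. -/
noncomputable def maxPairDensity {V : Type*} {G : SimpleGraph V} (H : G.Subgraph) : ℝ :=
  sSup {x : ℝ | ∃ K : G.Subgraph, H < K ∧ x = pairDensity K H}

/-- `f_α(K,H) = v(K,H) - α·e(K,H)`. -/
noncomputable def fAlpha (α : ℝ) {V : Type*} {G : SimpleGraph V} (K H : G.Subgraph) : ℝ :=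
  ((Nat.card K.verts : ℝ) - (Nat.card H.verts : ℝ)) -
    α * ((Nat.card K.edgeSet : ℝ) - (Nat.card H.edgeSet : ℝ))

/-- The pair `(G,H)` is `α`-safe: `f_α(S,H) > 0` for every `S` with `H ⊂ S ⊆ G`. -/
def AlphaSafe (α : ℝ) {V : Type*} (G : SimpleGraph V) (H : G.Subgraph) : Prop :=
  ∀ S : G.Subgraph, H < S → 0 < fAlpha α S H

/-- The pair `(G,H)` is strictly balanced: `ρ(G,H) > ρ(K,H)` for every `H ⊂ K ⊂ G`. -/
def StrictlyBalancedPair {V : Type*} (G : SimpleGraph V) (H : G.Subgraph) : Prop :=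
  ∀ K : G.Subgraph, H < K → K ≠ ⊤ → pairDensity K H < pairDensity (⊤ : G.Subgraph) H

/-- The set `E(K) \ (E(H) ∪ E(K∖H))` is non-empty: `K` has an edge, not an edge of `H`,
with at least one endpoint in `V(H)`. -/
def TouchesRoots {V : Type*} {G : SimpleGraph V} (H K : G.Subgraph) : Prop :=
  ∃ u v : V, K.Adj u v ∧ ¬H.Adj u v ∧ (u ∈ H.verts ∨ v ∈ H.verts)

/-- `e^min(G,H)` (`G` being the top subgraph). -/
noncomputable def eMin {V : Type*} {G : SimpleGraph V} (H : G.Subgraph) : ℕ :=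
  sInf {e : ℕ | ∃ K : G.Subgraph, H < K ∧ TouchesRoots H K ∧
    pairDensity K H = maxPairDensity H ∧ e = Nat.card K.edgeSet - Nat.card H.edgeSet}

/-- `f` realizes a `(G,(r 0,…,r (m-1)))`-extension of the tuple `x` in `Γ`: an injective copy
of the vertex set of `G` sending the roots to `x` and containing all edges of `E(G)∖E(H)`
as edges outside the root-induced subgraph. -/
def IsExtension {W V : Type*} (Gp : SimpleGraph W) (H : Gp.Subgraph) {m : ℕ}
    (r : Fin m → W) (Γ : SimpleGraph V) (x : Fin m → V) (f : W → V) : Prop :=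
  Function.Injective f ∧ (∀ j : Fin m, f (r j) = x j) ∧
    ∀ u v : W, Gp.Adj u v → ¬H.Adj u v →
      Γ.Adj (f u) (f v) ∧ ¬(u ∈ H.verts ∧ v ∈ H.verts)

/-- Strict extension: the implication above is an equivalence. -/
def IsStrictExtension {W V : Type*} (Gp : SimpleGraph W) (H : Gp.Subgraph) {m : ℕ}
    (r : Fin m → W) (Γ : SimpleGraph V) (x : Fin m → V) (f : W → V) : Prop :=
  Function.Injective f ∧ (∀ j : Fin m, f (r j) = x j) ∧
    ∀ u v : W, (Gp.Adj u v ∧ ¬H.Adj u v) ↔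
      (Γ.Adj (f u) (f v) ∧ ¬(u ∈ H.verts ∧ v ∈ H.verts))

/-- The pair of subgraphs of `Γ` with vertex sets `B ⊆ A` is `(K,T)`-maximal in `Γ`
(where `T ⊂ K` has roots enumerated by `s`). -/
def PairMaximal {U V : Type*} (Kp : SimpleGraph U) (T : Kp.Subgraph) {t : ℕ}
    (s : Fin t → U) (Γ : SimpleGraph V) (A B : Set V) : Prop :=
  ∀ tup : Fin t → V, Function.Injective tup → (∀ i, tup i ∈ A) → (∃ i, tup i ∉ B) →
    ¬∃ f : U → V, IsStrictExtension Kp T s Γ tup f ∧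
      (∀ u : U, f u ∈ A → f u ∈ Set.range tup) ∧
      (∀ u : U, f u ∉ Set.range tup → ∀ a ∈ A, a ∉ Set.range tup → ¬Γ.Adj (f u) a)

/-- The subgraph of `Γ` with vertex set `A` is `(K,T)`-maximal in `Γ`. -/
def GraphMaximal {U V : Type*} (Kp : SimpleGraph U) (T : Kp.Subgraph) {t : ℕ}
    (s : Fin t → U) (Γ : SimpleGraph V) (A : Set V) : Prop :=
  ∀ tup : Fin t → V, Function.Injective tup → (∀ i, tup i ∈ A) →
    ¬∃ f : U → V, IsStrictExtension Kp T s Γ tup f ∧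
      (∀ u : U, f u ∈ A → f u ∈ Set.range tup) ∧
      (∀ u : U, f u ∉ Set.range tup → ∀ a ∈ A, a ∉ Set.range tup → ¬Γ.Adj (f u) a)

/-- `Γ` contains a copy of `Gp`. -/
def ContainsCopy {W V : Type*} (Gp : SimpleGraph W) (Γ : SimpleGraph V) : Prop :=
  ∃ f : W → V, Function.Injective f ∧ ∀ u v : W, Gp.Adj u v → Γ.Adj (f u) (f v)

/-- The number of copies of `Gp` in `Γ`: subgraphs of `Γ` isomorphic to `Gp`. -/
noncomputable def numCopies {W V : Type*} (Gp : SimpleGraph W) (Γ : SimpleGraph V) : ℕ :=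
  Nat.card {H : Γ.Subgraph // Nonempty (Gp ≃g H.coe)}

/-- The matched tuples of chosen vertices induce a partial isomorphism. -/
def PartialIso {V W : Type*} (G : SimpleGraph V) (H : SimpleGraph W)
    (xs : List V) (ys : List W) : Prop :=
  ∃ h : xs.length = ys.length,
    ∀ j k : Fin xs.length,
      (xs.get j = xs.get k ↔ ys.get (Fin.cast h j) = ys.get (Fin.cast h k)) ∧
      (G.Adj (xs.get j) (xs.get k) ↔ H.Adj (ys.get (Fin.cast h j)) (ys.get (Fin.cast h k)))

/-- Duplicator has a winning strategy in the remaining `i` rounds of the Ehrenfeucht game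
on `(G,H)` from the position given by the already chosen vertices `xs`, `ys`. -/
def DuplicatorWinsFrom {V W : Type*} (G : SimpleGraph V) (H : SimpleGraph W) :
    ℕ → List V → List W → Prop
  | 0, xs, ys => PartialIso G H xs ys
  | (i + 1), xs, ys =>
      (∀ x : V, ∃ y : W, DuplicatorWinsFrom G H i (x :: xs) (y :: ys)) ∧
      (∀ y : W, ∃ x : V, DuplicatorWinsFrom G H i (x :: xs) (y :: ys))

/-- Duplicator has a winning strategy in the Ehrenfeucht game `EHR(G,H,i)`. -/
def DuplicatorWins {V W : Type*} (G : SimpleGraph V) (H : SimpleGraph W) (i : ℕ) : Prop :=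
  DuplicatorWinsFrom G H i [] []

end RandomGraphSpectra

namespace RandomGraphSpectra

/-- The class `𝒮` of graphs from Section "Properties which imply the existence of
Duplicator's winning strategy" (properties 1)–3)). -/
def GoodGraph (k b : ℕ) (α : ℝ) {V : Type*} (Γ : SimpleGraph V) : Prop :=
  -- 1) no strictly balanced subgraph with at most `2^{2k}·b` vertices and density `> 1/α`
  (∀ A : Γ.Subgraph, Nat.card A.verts ≤ 2 ^ (2 * k) * b → StrictlyBalanced A.coe →
      density A.coe ≤ 1 / α) ∧
  -- 2) strict extensions of α-safe pairs which are `(K₁,K₂)`-maximal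
  (∀ (l h : ℕ) (H₁ : SimpleGraph (Fin l)) (H₂ : H₁.Subgraph) (r : Fin h → Fin l),
      Function.Injective r → Set.range r = H₂.verts →
      l ≤ 2 ^ (2 * k) * b + k * 2 ^ k → AlphaSafe α H₁ H₂ →
      ∀ x : Fin h → V, Function.Injective x →
        ∃ f : Fin l → V, IsStrictExtension H₁ H₂ r Γ x f ∧
          ∀ (u t : ℕ) (K₁ : SimpleGraph (Fin u)) (K₂ : K₁.Subgraph) (s : Fin t → Fin u),
            Function.Injective s → Set.range s = K₂.verts →
            u ≤ 2 ^ k → Nat.card K₂.verts ≤ 2 → fAlpha α (⊤ : K₁.Subgraph) K₂ < 0 →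
            PairMaximal K₁ K₂ s Γ (Set.range f) (Set.range x)) ∧
  -- 3) maximal copies of sparse strictly balanced graphs
  (∀ (w : ℕ) (Hp : SimpleGraph (Fin w)), w ≤ 2 ^ (2 * k) * b → StrictlyBalanced Hp →
      density Hp < 1 / α →
      ∃ f : Fin w → V, Function.Injective f ∧
        (∀ u v : Fin w, Hp.Adj u v → Γ.Adj (f u) (f v)) ∧
        ∀ (u t : ℕ) (K₁ : SimpleGraph (Fin u)) (K₂ : K₁.Subgraph) (s : Fin t → Fin u),
          Function.Injective s → Set.range s = K₂.verts →
          u ≤ 2 ^ k → Nat.card K₂.verts ≤ 2 → fAlpha α (⊤ : K₁.Subgraph) K₂ < 0 →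
          GraphMaximal K₁ K₂ s Γ (Set.range f))

end RandomGraphSpectra

namespace RandomGraphSpectra

/-! ## The sentence -/

/-- `b` can be reached from `a` by a walk of length at most `l`. -/
def Near {V : Type*} (G : SimpleGraph V) (l : ℕ) (a b : V) : Prop :=
  ∃ p : G.Walk a b, p.length ≤ l

/-- The graph with all edges at `x` removed. -/
def delG {V : Type*} (G : SimpleGraph V) (x : V) : SimpleGraph V where
  Adj u v := G.Adj u v ∧ u ≠ x ∧ v ≠ x
  symm := ⟨fun _ _ h => ⟨h.1.symm, h.2.2, h.2.1⟩⟩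
  loopless := ⟨fun _ h => G.loopless.irrefl _ h.1⟩

/-- `a` lies outside the ball of radius `D` at `x` and has two neighbours inside. -/
def InS {V : Type*} (G : SimpleGraph V) (D : ℕ) (x a : V) : Prop :=
  ¬ Near G D x a ∧ ∃ b c, b ≠ c ∧ G.Adj a b ∧ G.Adj a c ∧ Near G D x b ∧ Near G D x c

/-- The property expressed by our sentence. -/
def PL {V : Type*} (G : SimpleGraph V) (N D : ℕ) : Prop :=
  ∀ x, ∃ w, w ≠ x ∧ ∀ s, InS G D x s → Near (delG G x) N w s

lemma near_zero {V : Type*} (G : SimpleGraph V) (a b : V) : Near G 0 a b ↔ a = b := by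
  constructor
  · rintro ⟨p, hp⟩
    exact SimpleGraph.Walk.eq_of_length_eq_zero (Nat.le_zero.mp hp)
  · rintro rfl
    exact ⟨.nil, le_rfl⟩

lemma near_one {V : Type*} (G : SimpleGraph V) (a b : V) : Near G 1 a b ↔ a = b ∨ G.Adj a b := by
  constructor
  · rintro ⟨p, hp⟩
    cases p with
    | nil => left; rfl
    | cons h q =>
      simp at hp
      have := hp.eq
      subst this
      right; exact h
  · rintro (rfl | h)
    · exact ⟨.nil, by simp⟩
    · exact ⟨h.toWalk, by simp⟩

lemma near_add {V : Type*} (G : SimpleGraph V) (l l' : ℕ) (a b : V) :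
    Near G (l + l') a b ↔ ∃ z, Near G l a z ∧ Near G l' z b := by
  constructor
  · rintro ⟨p, hp⟩
    exact ⟨p.getVert l, ⟨p.take l, by rw [SimpleGraph.Walk.take_length]; omega⟩,
      ⟨p.drop l, by rw [SimpleGraph.Walk.drop_length]; omega⟩⟩
  · rintro ⟨z, ⟨p, hp⟩, q, hq⟩
    exact ⟨p.append q, by rw [SimpleGraph.Walk.length_append]; omega⟩

/-- variable terms -/
abbrev vr {n : ℕ} (i : Fin n) : Language.graph.Term (Empty ⊕ Fin n) := Language.Term.var (Sum.inr i)

/-- adjacency -/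
def adjF {n : ℕ} (a b : Fin n) : Language.graph.BoundedFormula Empty n :=
  Language.Relations.boundedFormula₂ Language.adj (vr a) (vr b)

/-- equality -/
def eqF {n : ℕ} (a b : Fin n) : Language.graph.BoundedFormula Empty n :=
  Language.Term.bdEqual (vr a) (vr b)

/-- formula for walks of bounded length, possibly avoiding `x` -/
def nearF (av : Bool) : ∀ (_ _ : ℕ) {n : ℕ} (_ _ _ : Fin n), Language.graph.BoundedFormula Empty n
  | 0, l, _, x, a, b =>
      eqF a b ⊔ (if l = 0 then ⊥ else
        (adjF a b ⊓ (if av then (eqF a x).not ⊓ (eqF b x).not else ⊤)))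
  | d + 1, l, _, x, a, b =>
      (nearF av d (min l (2 ^ d)) x.castSucc a.castSucc (Fin.last _) ⊓
        nearF av d (l - 2 ^ d) x.castSucc (Fin.last _) b.castSucc).ex

section depth
variable {L : FirstOrder.Language} {β : Type*} {n : ℕ}
lemma qD_not (f : L.BoundedFormula β n) : qDepth f.not = qDepth f := by
  simp [qDepth]
lemma qD_bot : qDepth (⊥ : L.BoundedFormula β n) = 0 := rfl
lemma qD_top : qDepth (⊤ : L.BoundedFormula β n) = 0 := by
  change qDepth (Language.BoundedFormula.not ⊥) = 0
  rw [qD_not]; rfl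
lemma qD_imp (f g : L.BoundedFormula β n) : qDepth (f.imp g) = max (qDepth f) (qDepth g) := rfl
lemma qD_inf (f g : L.BoundedFormula β n) : qDepth (f ⊓ g) = max (qDepth f) (qDepth g) := by
  change qDepth (Language.BoundedFormula.not (f.imp g.not)) = _
  rw [qD_not, qD_imp, qD_not]
lemma qD_sup (f g : L.BoundedFormula β n) : qDepth (f ⊔ g) = max (qDepth f) (qDepth g) := by
  change qDepth (f.not.imp g) = _
  rw [qD_imp, qD_not]
lemma qD_all (f : L.BoundedFormula β (n + 1)) : qDepth f.all = qDepth f + 1 := rfl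
lemma qD_ex (f : L.BoundedFormula β (n + 1)) : qDepth f.ex = qDepth f + 1 := by
  rw [Language.BoundedFormula.ex, qD_not, qD_all, qD_not]
end depth

lemma qD_adj {n : ℕ} (a b : Fin n) : qDepth (adjF a b) = 0 := rfl
lemma qD_eq {n : ℕ} (a b : Fin n) : qDepth (eqF a b) = 0 := rfl

lemma qD_near (av : Bool) (d l : ℕ) {n : ℕ} (x a b : Fin n) : qDepth (nearF av d l x a b) ≤ d := by
  induction d generalizing l n with
  | zero =>
    rw [nearF]
    split_ifs <;> simp [qD_sup, qD_inf, qD_bot, qD_top, qD_adj, qD_eq, qD_not]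
  | succ d ih =>
    rw [nearF, qD_ex, qD_inf]
    have := ih (min l (2 ^ d)) x.castSucc a.castSucc (Fin.last _)
    have := ih (l - 2 ^ d) x.castSucc (Fin.last _) b.castSucc
    omega

section sem
variable {V : Type} (G : SimpleGraph V)

/-- realization in a graph -/
def Rz {n : ℕ} (f : Language.graph.BoundedFormula Empty n) (xs : Fin n → V) : Prop :=
  @Language.BoundedFormula.Realize Language.graph V G.structure Empty n f (default : Empty → V) xs

variable {n : ℕ} (xs : Fin n → V)
lemma rz_adj (a b : Fin n) : Rz G (adjF a b) xs ↔ G.Adj (xs a) (xs b) := by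
  let := G.structure
  rw [Rz, adjF, Language.BoundedFormula.realize_rel₂]
  rfl
lemma rz_eq (a b : Fin n) : Rz G (eqF a b) xs ↔ xs a = xs b := by
  let := G.structure
  rw [Rz, eqF, Language.BoundedFormula.realize_bdEqual]
  rfl
lemma rz_not (f : Language.graph.BoundedFormula Empty n) : Rz G f.not xs ↔ ¬ Rz G f xs := Iff.rfl
lemma rz_bot : Rz G (⊥ : Language.graph.BoundedFormula Empty n) xs ↔ False := Iff.rfl
lemma rz_top : Rz G (⊤ : Language.graph.BoundedFormula Empty n) xs ↔ True := by
  let := G.structure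
  exact Language.BoundedFormula.realize_top
lemma rz_imp (f g : Language.graph.BoundedFormula Empty n) :
    Rz G (f.imp g) xs ↔ (Rz G f xs → Rz G g xs) := Iff.rfl
lemma rz_inf (f g : Language.graph.BoundedFormula Empty n) :
    Rz G (f ⊓ g) xs ↔ (Rz G f xs ∧ Rz G g xs) := by
  let := G.structure
  exact Language.BoundedFormula.realize_inf
lemma rz_sup (f g : Language.graph.BoundedFormula Empty n) :
    Rz G (f ⊔ g) xs ↔ (Rz G f xs ∨ Rz G g xs) := by
  let := G.structure
  exact Language.BoundedFormula.realize_sup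
lemma rz_all (f : Language.graph.BoundedFormula Empty (n + 1)) :
    Rz G f.all xs ↔ ∀ z, Rz G f (Fin.snoc xs z) := Iff.rfl
lemma rz_ex (f : Language.graph.BoundedFormula Empty (n + 1)) :
    Rz G f.ex xs ↔ ∃ z, Rz G f (Fin.snoc xs z) := by
  let := G.structure
  exact Language.BoundedFormula.realize_ex

lemma rz_near (av : Bool) (d l : ℕ) (hl : l ≤ 2 ^ d) {n : ℕ} (xs : Fin n → V) (x a b : Fin n) :
    Rz G (nearF av d l x a b) xs ↔
      Near (if av then delG G (xs x) else G) l (xs a) (xs b) := by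
  induction d generalizing l n with
  | zero =>
    have : l = 0 ∨ l = 1 := by simp at hl; omega
    rcases this with rfl | rfl
    · simp [nearF, rz_sup, rz_eq, rz_bot, near_zero]
    · cases av <;> simp [nearF, rz_sup, rz_eq, rz_inf, rz_adj, rz_not, rz_top, near_one, delG]
  | succ d ih =>
    rw [pow_succ] at hl
    rw [nearF, rz_ex]
    simp only [rz_inf]
    have h1 : l = min l (2 ^ d) + (l - 2 ^ d) := by omega
    conv_rhs => rw [h1, near_add]
    refine exists_congr fun z => ?_
    rw [ih _ (by omega), ih _ (by omega)]
    simp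
end sem

/-- The membership formula for `InS`. -/
def inSF (d D : ℕ) {n : ℕ} (x a : Fin n) : Language.graph.BoundedFormula Empty n :=
  (nearF false d D x x a).not ⊓
   ((((eqF (Fin.last n).castSucc (Fin.last (n + 1))).not ⊓
      (adjF a.castSucc.castSucc (Fin.last n).castSucc ⊓
       (adjF a.castSucc.castSucc (Fin.last (n + 1)) ⊓
        (nearF false d D x.castSucc.castSucc x.castSucc.castSucc (Fin.last n).castSucc ⊓
         nearF false d D x.castSucc.castSucc x.castSucc.castSucc (Fin.last (n + 1))))))).ex).ex

/-- the sentence -/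
def theS (d d' N D : ℕ) : Language.graph.Sentence :=
  (((eqF (1 : Fin 2) 0).not ⊓
    ((inSF d' D (0 : Fin 3) 2).imp (nearF true d N (0 : Fin 3) 1 2)).all).ex).all

lemma rz_inS {V : Type} (G : SimpleGraph V) (d D : ℕ) (hD : D ≤ 2 ^ d) {n : ℕ} (xs : Fin n → V)
    (x a : Fin n) : Rz G (inSF d D x a) xs ↔ InS G D (xs x) (xs a) := by
  simp [inSF, InS, rz_inf, rz_not, rz_ex, rz_eq, rz_adj, rz_near G false d D hD]

lemma exists_sentence (k : ℕ) (hk : 8 ≤ k) : ∃ φ : Language.graph.Sentence, qDepth φ ≤ k ∧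
    ∀ (V : Type) (G : SimpleGraph V), GraphSat G φ ↔ PL G (2 ^ (k - 5)) (2 ^ (k - 6) - 1) := by
  refine ⟨theS (k - 5) (k - 6) (2 ^ (k - 5)) (2 ^ (k - 6) - 1), ?_, ?_⟩
  · have h1 := fun (n : ℕ) (x a b : Fin n) => qD_near true (k - 5) (2 ^ (k - 5)) x a b
    have h2 := fun (n : ℕ) (x a b : Fin n) => qD_near false (k - 6) (2 ^ (k - 6) - 1) x a b
    simp only [theS, inSF, qD_all, qD_ex, qD_inf, qD_not, qD_imp, qD_eq, qD_adj]
    have := h1 3 0 1 2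
    have := h2 3 0 0 2
    have := h2 5 (0 : Fin 3).castSucc.castSucc (0 : Fin 3).castSucc.castSucc (Fin.last 3).castSucc
    have := h2 5 (0 : Fin 3).castSucc.castSucc (0 : Fin 3).castSucc.castSucc (Fin.last (3 + 1))
    omega
  · intro V G
    have : GraphSat G (theS (k - 5) (k - 6) (2 ^ (k - 5)) (2 ^ (k - 6) - 1)) ↔
      Rz G (theS (k - 5) (k - 6) (2 ^ (k - 5)) (2 ^ (k - 6) - 1)) default := Iff.rfl
    rw [this, theS, PL, rz_all]
    refine forall_congr' fun x => ?_
    rw [rz_ex]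
    refine exists_congr fun w => ?_
    rw [rz_inf, rz_not, rz_eq, rz_all]
    refine and_congr (by rfl) (forall_congr' fun s => ?_)
    rw [rz_imp, rz_inS _ _ _ (Nat.sub_le _ _), rz_near _ _ _ _ le_rfl]
    rfl

end RandomGraphSpectra

namespace RandomGraphSpectra

/-! ## Probability on finite graphs -/

section prob
open Classical

/-- The finite edge set of a graph. -/
noncomputable def eF {n : ℕ} (G : SimpleGraph (Fin n)) : Finset (Sym2 (Fin n)) :=
  Finset.univ.filter (· ∈ G.edgeSet)

lemma mem_eF {n : ℕ} (G : SimpleGraph (Fin n)) (e : Sym2 (Fin n)) : e ∈ eF G ↔ e ∈ G.edgeSet := by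
  simp [eF]

/-- indicator -/
noncomputable def ind (P : Prop) : ℝ := if P then 1 else 0

lemma ind_nonneg (P : Prop) : 0 ≤ ind P := by unfold ind; split_ifs <;> norm_num
lemma ind_le_one (P : Prop) : ind P ≤ 1 := by unfold ind; split_ifs <;> norm_num
lemma ind_of {P : Prop} (h : P) : ind P = 1 := if_pos h
lemma ind_of_not {P : Prop} (h : ¬ P) : ind P = 0 := if_neg h
lemma ind_and (P Q : Prop) : ind (P ∧ Q) = ind P * ind Q := by
  unfold ind; by_cases P <;> by_cases Q <;> simp [*]
lemma ind_not (P : Prop) : ind (¬ P) = 1 - ind P := by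
  unfold ind; by_cases P <;> simp [*]
lemma ind_mono {P Q : Prop} (h : P → Q) : ind P ≤ ind Q := by
  unfold ind; by_cases P <;> by_cases Q <;> simp_all

/-- expectation -/
noncomputable def Ex (n : ℕ) (p : ℝ) (f : SimpleGraph (Fin n) → ℝ) : ℝ :=
  ∑ G, weight n p G * f G

lemma probPred_eq (n : ℕ) (p : ℝ) (P : SimpleGraph (Fin n) → Prop) :
    probPred n p P = Ex n p (fun G => ind (P G)) := by
  rw [probPred, finsum_eq_sum_of_fintype, Ex]
  refine Finset.sum_congr rfl fun G _ => ?_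
  by_cases h : P G <;> simp [h, ind]

lemma edgeCount_eq {n : ℕ} (G : SimpleGraph (Fin n)) : edgeCount G = (eF G).card := by
  rw [edgeCount, eF, Nat.card_eq_fintype_card, ← Set.toFinset_card]
  congr 1
  ext e; simp

lemma weight_nonneg {n : ℕ} {p : ℝ} (h0 : 0 ≤ p) (h1 : p ≤ 1) (G : SimpleGraph (Fin n)) :
    0 ≤ weight n p G :=
  mul_nonneg (pow_nonneg h0 _) (pow_nonneg (by linarith) _)

/-- all possible edges -/
noncomputable def allE (n : ℕ) : Finset (Sym2 (Fin n)) := eF (⊤ : SimpleGraph (Fin n))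

lemma mem_allE {n : ℕ} (e : Sym2 (Fin n)) : e ∈ allE n ↔ ¬ e.IsDiag := by
  rw [allE, mem_eF]; simp

lemma card_allE (n : ℕ) : (allE n).card = n.choose 2 := by
  rw [allE, ← edgeCount_eq, edgeCount, Nat.card_eq_fintype_card, ← SimpleGraph.edgeFinset_card,
    SimpleGraph.card_edgeFinset_top_eq_card_choose_two, Fintype.card_fin]

lemma eF_subset {n : ℕ} (G : SimpleGraph (Fin n)) : eF G ⊆ allE n := by
  intro e he
  rw [mem_allE]
  exact G.not_isDiag_of_mem_edgeSet ((mem_eF _ _).1 he)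

lemma sum_graphs {n : ℕ} (g : Finset (Sym2 (Fin n)) → ℝ) :
    ∑ G : SimpleGraph (Fin n), g (eF G) = ∑ S ∈ (allE n).powerset, g S := by
  refine Finset.sum_bij' (fun G _ => eF G)
    (fun S _ => SimpleGraph.fromEdgeSet (S : Set (Sym2 (Fin n)))) ?_ ?_ ?_ ?_ ?_
  · intro G _; exact Finset.mem_powerset.2 (eF_subset G)
  · intro _ _; exact Finset.mem_univ _
  · intro G _
    have : (eF G : Set (Sym2 (Fin n))) = G.edgeSet := by ext e; simp [mem_eF]
    simp [this]
  · intro S hS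
    ext e
    rw [mem_eF]
    have : e ∈ S → ¬ e.IsDiag := fun h => (mem_allE e).1 (Finset.mem_powerset.1 hS h)
    simp; exact this
  · intro _ _; rfl

lemma Ex_inc {n : ℕ} (p : ℝ) (F : Finset (Sym2 (Fin n))) (hF : F ⊆ allE n) :
    Ex n p (fun G => ind (F ⊆ eF G)) = p ^ F.card := by
  have h1 : Ex n p (fun G => ind (F ⊆ eF G)) =
      ∑ G : SimpleGraph (Fin n), (fun S : Finset (Sym2 (Fin n)) =>
        p ^ S.card * (1 - p) ^ ((allE n).card - S.card) * ind (F ⊆ S)) (eF G) := by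
    rw [Ex]
    refine Finset.sum_congr rfl fun G _ => ?_
    rw [weight, edgeCount_eq, card_allE]
  rw [h1]
  refine (sum_graphs (fun S : Finset (Sym2 (Fin n)) =>
        p ^ S.card * (1 - p) ^ ((allE n).card - S.card) * ind (F ⊆ S))).trans ?_
  have h2 : ∑ S ∈ (allE n).powerset, p ^ S.card * (1 - p) ^ ((allE n).card - S.card) * ind (F ⊆ S)
      = ∑ S ∈ (allE n).powerset with F ⊆ S, p ^ S.card * (1 - p) ^ ((allE n).card - S.card) := by
    rw [Finset.sum_filter]
    refine Finset.sum_congr rfl fun S _ => ?_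
    by_cases h : F ⊆ S <;> simp [ind, h]
  rw [h2]
  have h3 : ∑ S ∈ (allE n).powerset with F ⊆ S, p ^ S.card * (1 - p) ^ ((allE n).card - S.card)
      = ∑ S ∈ (allE n \ F).powerset, p ^ F.card *
        (p ^ S.card * (1 - p) ^ ((allE n \ F).card - S.card)) := by
    refine Finset.sum_bij' (fun S _ => S \ F) (fun S _ => S ∪ F) ?_ ?_ ?_ ?_ ?_
    · intro S hS
      simp only [Finset.mem_filter, Finset.mem_powerset] at hS ⊢
      exact Finset.sdiff_subset_sdiff hS.1 le_rfl
    · intro S hS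
      simp only [Finset.mem_filter, Finset.mem_powerset] at hS ⊢
      exact ⟨Finset.union_subset (hS.trans Finset.sdiff_subset) hF, Finset.subset_union_right⟩
    · intro S hS
      simp only [Finset.mem_filter, Finset.mem_powerset] at hS
      exact Finset.sdiff_union_of_subset hS.2
    · intro S hS
      simp only [Finset.mem_powerset] at hS
      rw [Finset.union_sdiff_right]
      exact Finset.sdiff_eq_self_of_disjoint (Finset.disjoint_of_subset_left hS Finset.sdiff_disjoint)
    · intro S hS
      simp only [Finset.mem_filter, Finset.mem_powerset] at hS
      rw [Finset.card_sdiff_of_subset hF, Finset.card_sdiff_of_subset hS.2, ← mul_assoc, ← pow_add]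
      have a := Finset.card_le_card hS.2
      have b := Finset.card_le_card hS.1
      congr 2 <;> omega
  rw [h3, ← Finset.mul_sum, Finset.sum_pow_mul_eq_add_pow]
  simp

lemma Ex_mono {n : ℕ} {p : ℝ} (h0 : 0 ≤ p) (h1 : p ≤ 1) {f g : SimpleGraph (Fin n) → ℝ}
    (h : ∀ G, f G ≤ g G) : Ex n p f ≤ Ex n p g :=
  Finset.sum_le_sum fun G _ => mul_le_mul_of_nonneg_left (h G) (weight_nonneg h0 h1 G)

lemma Ex_sum {n : ℕ} {p : ℝ} {ι : Type*} (s : Finset ι) (f : ι → SimpleGraph (Fin n) → ℝ) :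
    Ex n p (fun G => ∑ i ∈ s, f i G) = ∑ i ∈ s, Ex n p (f i) := by
  simp only [Ex, Finset.mul_sum]
  rw [Finset.sum_comm]

lemma Ex_mul {n : ℕ} {p : ℝ} (c : ℝ) (f : SimpleGraph (Fin n) → ℝ) :
    Ex n p (fun G => c * f G) = c * Ex n p f := by
  simp only [Ex, Finset.mul_sum]
  exact Finset.sum_congr rfl fun G _ => by ring

lemma Ex_sub {n : ℕ} {p : ℝ} (f g : SimpleGraph (Fin n) → ℝ) :
    Ex n p (fun G => f G - g G) = Ex n p f - Ex n p g := by
  simp only [Ex, ← Finset.sum_sub_distrib]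
  exact Finset.sum_congr rfl fun G _ => by ring

lemma Ex_one (n : ℕ) (p : ℝ) : Ex n p (fun _ => 1) = 1 := by
  have := Ex_inc (n := n) p ∅ (by simp)
  simpa [ind] using this

lemma Ex_nonneg {n : ℕ} {p : ℝ} (h0 : 0 ≤ p) (h1 : p ≤ 1) {f : SimpleGraph (Fin n) → ℝ}
    (h : ∀ G, 0 ≤ f G) : 0 ≤ Ex n p f :=
  Finset.sum_nonneg fun G _ => mul_nonneg (weight_nonneg h0 h1 G) (h G)

lemma weight_mul {n : ℕ} (p : ℝ) (a b : SimpleGraph (Fin n)) :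
    weight n p a * weight n p b = weight n p (a ⊓ b) * weight n p (a ⊔ b) := by
  have hs : eF (a ⊔ b) = eF a ∪ eF b := by
    ext e; simp [mem_eF]
  have hi : eF (a ⊓ b) = eF a ∩ eF b := by
    ext e; simp [mem_eF]
  have h := Finset.card_union_add_card_inter (eF a) (eF b)
  have ha := Finset.card_le_card (eF_subset a)
  have hb := Finset.card_le_card (eF_subset b)
  have hab := Finset.card_le_card (eF_subset (a ⊔ b))
  have hab' := Finset.card_le_card (eF_subset (a ⊓ b))
  rw [card_allE] at ha hb hab hab'
  rw [← hs, ← hi] at h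
  simp only [weight, edgeCount_eq]
  rw [mul_mul_mul_comm, ← pow_add, ← pow_add, mul_mul_mul_comm (p ^ _), ← pow_add, ← pow_add]
  congr 2 <;> omega

/-- Harris inequality for containment of finitely many edge sets, conditionally on `F ⊆ G`. -/
lemma harris {n : ℕ} {p : ℝ} (h0 : 0 ≤ p) (h1 : p ≤ 1) (F : Finset (Sym2 (Fin n)))
    (hF : F ⊆ allE n) (A : Finset (Finset (Sym2 (Fin n))))
    (hA : ∀ H ∈ A, H ⊆ allE n ∧ Disjoint F H) :
    p ^ F.card * ∏ H ∈ A, (1 - p ^ H.card) ≤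
      Ex n p (fun G => ind (F ⊆ eF G) * ind (∀ H ∈ A, ¬ H ⊆ eF G)) := by
  induction A using Finset.induction_on with
  | empty => simp [ind_of, Ex_inc p F hF]
  | insert H A hH ih =>
    have ih := ih (fun H' h' => hA H' (Finset.mem_insert_of_mem h'))
    obtain ⟨hHa, hHd⟩ := hA H (Finset.mem_insert_self _ _)
    have hmu : ∀ G : (SimpleGraph (Fin n))ᵒᵈ, 0 ≤ weight n p (OrderDual.ofDual G) *
        ind (F ⊆ eF (OrderDual.ofDual G)) :=
      fun G => mul_nonneg (weight_nonneg h0 h1 _) (ind_nonneg _)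
    have hsub : ∀ a b : SimpleGraph (Fin n), a ≤ b → eF a ⊆ eF b := by
      intro a b hab e he
      rw [mem_eF] at he ⊢
      exact SimpleGraph.edgeSet_mono hab he
    have key := fkg (α := (SimpleGraph (Fin n))ᵒᵈ)
      (μ := fun G => weight n p (OrderDual.ofDual G) * ind (F ⊆ eF (OrderDual.ofDual G)))
      (f := fun G => ind (¬ H ⊆ eF (OrderDual.ofDual G)))
      (g := fun G => ind (∀ H ∈ A, ¬ H ⊆ eF (OrderDual.ofDual G)))
      hmu (fun _ => ind_nonneg _) (fun _ => ind_nonneg _)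
      (fun a b hab => ind_mono fun h h' => h (h'.trans (hsub _ _ hab)))
      (fun a b hab => ind_mono fun h H' hH' h' => h H' hH' (h'.trans (hsub _ _ hab)))
      (by
        intro a b
        have e1 := weight_mul p (OrderDual.ofDual a) (OrderDual.ofDual b)
        have e2 : OrderDual.ofDual (a ⊓ b) = OrderDual.ofDual a ⊔ OrderDual.ofDual b := rfl
        have e3 : OrderDual.ofDual (a ⊔ b) = OrderDual.ofDual a ⊓ OrderDual.ofDual b := rfl
        simp only [e2, e3]
        rw [mul_mul_mul_comm (weight n p (OrderDual.ofDual a)),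
          mul_mul_mul_comm (weight n p (OrderDual.ofDual a ⊔ OrderDual.ofDual b)), e1,
          mul_comm (weight n p (OrderDual.ofDual a ⊓ _)), ← ind_and, ← ind_and]
        refine mul_le_mul_of_nonneg_left (ind_mono ?_)
          (mul_nonneg (weight_nonneg h0 h1 _) (weight_nonneg h0 h1 _))
        rintro ⟨ha, hb⟩
        refine ⟨ha.trans (hsub _ _ le_sup_left), ?_⟩
        intro e he
        have := ha he; have := hb he
        rw [mem_eF] at *
        rw [SimpleGraph.edgeSet_inf]; exact ⟨by assumption, by assumption⟩)
    have t1 : ∑ a : (SimpleGraph (Fin n))ᵒᵈ, weight n p (OrderDual.ofDual a) *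
        ind (F ⊆ eF (OrderDual.ofDual a)) = p ^ F.card := Ex_inc p F hF
    have t2 : ∑ a : (SimpleGraph (Fin n))ᵒᵈ, weight n p (OrderDual.ofDual a) *
        ind (F ⊆ eF (OrderDual.ofDual a)) * ind (¬ H ⊆ eF (OrderDual.ofDual a)) =
        p ^ F.card * (1 - p ^ H.card) := by
      have : Ex n p (fun G => ind (F ⊆ eF G) - ind (F ∪ H ⊆ eF G)) =
          p ^ F.card * (1 - p ^ H.card) := by
        rw [Ex_sub, Ex_inc p F hF, Ex_inc p _ (Finset.union_subset hF hHa),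
          Finset.card_union_of_disjoint hHd, pow_add]; ring
      rw [← this, Ex]
      have aux : ∀ G : SimpleGraph (Fin n), weight n p G * ind (F ⊆ eF G) * ind (¬ H ⊆ eF G) =
          weight n p G * (ind (F ⊆ eF G) - ind (F ∪ H ⊆ eF G)) := by
        intro G
        rw [Finset.union_subset_iff, ind_and, ind_not]
        ring
      exact Finset.sum_congr rfl fun G _ => aux G
    have t3 : ∑ a : (SimpleGraph (Fin n))ᵒᵈ, weight n p (OrderDual.ofDual a) *
        ind (F ⊆ eF (OrderDual.ofDual a)) * ind (∀ H ∈ A, ¬ H ⊆ eF (OrderDual.ofDual a)) =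
        Ex n p (fun G => ind (F ⊆ eF G) * ind (∀ H ∈ A, ¬ H ⊆ eF G)) := by
      rw [Ex]
      refine Finset.sum_congr rfl fun G _ => ?_
      rw [mul_assoc]; rfl
    have t4 : ∑ a : (SimpleGraph (Fin n))ᵒᵈ, weight n p (OrderDual.ofDual a) *
        ind (F ⊆ eF (OrderDual.ofDual a)) * (ind (¬ H ⊆ eF (OrderDual.ofDual a)) *
          ind (∀ H ∈ A, ¬ H ⊆ eF (OrderDual.ofDual a))) =
        Ex n p (fun G => ind (F ⊆ eF G) * ind (∀ H' ∈ insert H A, ¬ H' ⊆ eF G)) := by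
      rw [Ex]
      refine Finset.sum_congr rfl fun G _ => ?_
      rw [mul_assoc, ← ind_and]
      simp only [Finset.forall_mem_insert]; rfl
    rw [t1, t2, t3, t4] at key
    rw [Finset.prod_insert hH]
    rcases (pow_nonneg h0 F.card).eq_or_lt with hz | hz
    · rw [← hz, zero_mul]
      exact Ex_nonneg h0 h1 fun G => mul_nonneg (ind_nonneg _) (ind_nonneg _)
    · have hH1 : 0 ≤ 1 - p ^ H.card := by
        have := pow_le_one₀ (n := H.card) h0 h1; linarith
      have := mul_le_mul_of_nonneg_left ih (mul_nonneg hz.le hH1)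
      nlinarith [this.trans key]

end prob

end RandomGraphSpectra

namespace RandomGraphSpectra

/-! ## No dense sub-configurations -/

section good
open Classical

/-- vertices covered by a finite set of edges -/
noncomputable def vE {V : Type*} (H : Finset (Sym2 V)) : Finset V :=
  H.biUnion Sym2.toFinset

lemma mem_vE {V : Type*} (H : Finset (Sym2 V)) (v : V) : v ∈ vE H ↔ ∃ e ∈ H, v ∈ e := by
  simp [vE]

lemma card_vE_le {V : Type*} (H : Finset (Sym2 V)) : (vE H).card ≤ 2 * H.card := by
  rw [vE, mul_comm]
  refine Finset.card_biUnion_le_card_mul _ _ _ fun e _ => ?_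
  rw [Sym2.card_toFinset]; split_ifs <;> norm_num

/-- the dense configurations over the roots `R`, avoiding the edges `F` -/
noncomputable def Bad (n : ℕ) (α : ℝ) (B : ℕ) (R : Finset (Fin n)) (F : Finset (Sym2 (Fin n))) :
    Finset (Finset (Sym2 (Fin n))) :=
  (allE n).powerset.filter (fun H => H.Nonempty ∧ Disjoint F H ∧ H.card ≤ B ∧
    ((vE H \ R).card : ℝ) ≤ α * H.card)

lemma bad_sum {n : ℕ} (hn : 1 ≤ n) {α : ℝ} (B r : ℕ) (R : Finset (Fin n))
    (F : Finset (Sym2 (Fin n))) (hR : R.card ≤ r) :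
    ∑ H ∈ Bad n α B R F, ((n : ℝ) ^ (-α)) ^ H.card ≤
      (2 * B + 1) * 2 ^ (2 * B + r + 1).choose 2 := by
  have hn1 : (1 : ℝ) ≤ n := by exact_mod_cast hn
  have hn0 : (0 : ℝ) < n := by linarith
  set A : Finset (Finset (Fin n)) := Finset.univ.filter (fun U => U.card ≤ 2 * B) with hA
  have hmaps : ∀ H ∈ Bad n α B R F, vE H \ R ∈ A := by
    intro H hH
    simp only [Bad, Finset.mem_filter] at hH
    simp only [hA, Finset.mem_filter, Finset.mem_univ, true_and]
    have := card_vE_le H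
    have := Finset.card_le_card (Finset.sdiff_subset (s := vE H) (t := R))
    omega
  rw [← Finset.sum_fiberwise_of_maps_to hmaps]
  have h1 : ∀ U ∈ A, ∑ H ∈ Bad n α B R F with vE H \ R = U, ((n : ℝ) ^ (-α)) ^ H.card ≤
      2 ^ (2 * B + r + 1).choose 2 * ((n : ℝ)⁻¹) ^ U.card := by
    intro U hU
    simp only [hA, Finset.mem_filter, Finset.mem_univ, true_and] at hU
    have hb : ∀ H ∈ (Bad n α B R F).filter (fun H => vE H \ R = U),
        ((n : ℝ) ^ (-α)) ^ H.card ≤ ((n : ℝ)⁻¹) ^ U.card := by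
      intro H hH
      simp only [Bad, Finset.mem_filter] at hH
      rw [← Real.rpow_natCast, ← Real.rpow_mul hn0.le, inv_pow, ← Real.rpow_natCast,
        ← Real.rpow_neg hn0.le]
      refine Real.rpow_le_rpow_of_exponent_le hn1 ?_
      have := hH.1.2.2.2.2
      rw [hH.2] at this
      linarith
    refine (Finset.sum_le_card_nsmul _ _ _ hb).trans ?_
    rw [nsmul_eq_mul]
    refine mul_le_mul_of_nonneg_right ?_ (by positivity)
    have hs : (Bad n α B R F).filter (fun H => vE H \ R = U) ⊆ ((U ∪ R).sym2).powerset := by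
      intro H hH
      simp only [Finset.mem_filter] at hH
      rw [Finset.mem_powerset]
      intro e he
      rw [Finset.mem_sym2_iff]
      intro v hv
      have : v ∈ vE H := (mem_vE _ _).2 ⟨e, he, hv⟩
      rw [← hH.2]
      simp [this]
    have h2 := Finset.card_le_card hs
    rw [Finset.card_powerset, Finset.card_sym2] at h2
    have h3 : (U ∪ R).card + 1 ≤ 2 * B + r + 1 := by
      have := Finset.card_union_le U R; omega
    have h4 := Nat.choose_le_choose 2 h3
    exact_mod_cast h2.trans (Nat.pow_le_pow_right (by norm_num) h4)
  refine (Finset.sum_le_sum h1).trans ?_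
  rw [← Finset.mul_sum, mul_comm]
  refine mul_le_mul_of_nonneg_right ?_ (by positivity)
  have hm2 : ∀ U ∈ A, U.card ∈ Finset.range (2 * B + 1) := by
    intro U hU
    simp only [hA, Finset.mem_filter, Finset.mem_univ, true_and] at hU
    simp; omega
  rw [← Finset.sum_fiberwise_of_maps_to hm2]
  have h5 : ∀ u ∈ Finset.range (2 * B + 1), ∑ U ∈ A with U.card = u, ((n : ℝ)⁻¹) ^ U.card ≤ 1 := by
    intro u _
    have : ∑ U ∈ A with U.card = u, ((n : ℝ)⁻¹) ^ U.card =
        ∑ U ∈ A with U.card = u, ((n : ℝ)⁻¹) ^ u :=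
      Finset.sum_congr rfl fun U hU => by rw [(Finset.mem_filter.1 hU).2]
    rw [this, Finset.sum_const, nsmul_eq_mul]
    have hs : A.filter (fun U => U.card = u) ⊆ Finset.powersetCard u Finset.univ := by
      intro U hU
      rw [Finset.mem_powersetCard]
      exact ⟨Finset.subset_univ _, (Finset.mem_filter.1 hU).2⟩
    have h2 := Finset.card_le_card hs
    rw [Finset.card_powersetCard, Finset.card_univ, Fintype.card_fin] at h2
    have h3 : ((A.filter (fun U => U.card = u)).card : ℝ) ≤ (n : ℝ) ^ u := by
      exact_mod_cast h2.trans (Nat.choose_le_pow n u)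
    calc _ ≤ (n : ℝ) ^ u * ((n : ℝ)⁻¹) ^ u := mul_le_mul_of_nonneg_right h3 (by positivity)
      _ = 1 := by rw [← mul_pow, mul_inv_cancel₀ hn0.ne', one_pow]
  refine (Finset.sum_le_card_nsmul _ _ _ h5).trans ?_
  simp

lemma one_sub_ge_exp {t : ℝ} (h0 : 0 ≤ t) (h : t ≤ 1 / 2) : Real.exp (-(2 * t)) ≤ 1 - t := by
  have h1 : 0 < 1 - t := by linarith
  rw [← Real.le_log_iff_exp_le h1]
  have := Real.one_sub_inv_le_log_of_pos h1
  refine le_trans ?_ this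
  rw [← sub_nonneg]
  have : 1 - (1 - t)⁻¹ - -(2 * t) = t * (1 - 2 * t) / (1 - t) := by field_simp; ring
  rw [this]
  exact div_nonneg (mul_nonneg h0 (by linarith)) h1.le

lemma tendsto_p {α : ℝ} (hα : 0 < α) : Tendsto (fun n : ℕ => (n : ℝ) ^ (-α)) atTop (𝓝 0) :=
  (tendsto_rpow_neg_atTop hα).comp tendsto_natCast_atTop_atTop

lemma good_bound {α : ℝ} (hα : 0 < α) (r B : ℕ) : ∃ c : ℝ, 0 < c ∧ ∀ᶠ n : ℕ in atTop,
    ∀ (R : Finset (Fin n)) (F : Finset (Sym2 (Fin n))), R.card ≤ r → F ⊆ allE n →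
      c * ((n : ℝ) ^ (-α)) ^ F.card ≤ Ex n ((n : ℝ) ^ (-α))
        (fun G => ind (F ⊆ eF G) * ind (∀ H ∈ Bad n α B R F, ¬ H ⊆ eF G)) := by
  refine ⟨Real.exp (-(2 * ((2 * B + 1) * 2 ^ (2 * B + r + 1).choose 2))), Real.exp_pos _, ?_⟩
  filter_upwards [(tendsto_p hα).eventually (ge_mem_nhds (by norm_num : (0:ℝ) < 1/2)),
    eventually_ge_atTop 1] with n hp hn R F hR hF
  have hp0 : (0:ℝ) ≤ (n : ℝ) ^ (-α) := by positivity
  have := harris hp0 (by linarith) F hF (Bad n α B R F) (by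
    intro H hH
    simp only [Bad, Finset.mem_filter, Finset.mem_powerset] at hH
    exact ⟨hH.1, hH.2.2.1⟩)
  refine le_trans ?_ this
  rw [mul_comm]
  refine mul_le_mul_of_nonneg_left ?_ (by positivity)
  calc _ ≤ Real.exp (∑ H ∈ Bad n α B R F, -(2 * ((n : ℝ) ^ (-α)) ^ H.card)) := by
        apply Real.exp_le_exp.2
        rw [Finset.sum_neg_distrib, ← Finset.mul_sum]
        have := bad_sum hn B r R F hR (α := α)
        linarith
    _ = ∏ H ∈ Bad n α B R F, Real.exp (-(2 * ((n : ℝ) ^ (-α)) ^ H.card)) := Real.exp_sum _ _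
    _ ≤ _ := by
        refine Finset.prod_le_prod (fun _ _ => (Real.exp_pos _).le) fun H hH => ?_
        simp only [Bad, Finset.mem_filter, Finset.mem_powerset] at hH
        refine one_sub_ge_exp (by positivity) ?_
        have h1 : 1 ≤ H.card := Finset.card_pos.2 hH.2.1
        calc ((n : ℝ) ^ (-α)) ^ H.card ≤ ((n : ℝ) ^ (-α)) ^ 1 :=
              pow_le_pow_of_le_one hp0 (by linarith) h1
          _ ≤ 1 / 2 := by rw [pow_one]; exact hp

end good

end RandomGraphSpectra

namespace RandomGraphSpectra

/-! ## Second moments of partite embeddings of rooted patterns -/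

section pattern
open Classical

variable {U R I : Type} [Fintype U] [Fintype I] {n M : ℕ}

/-- the embedding of a pattern -/
def emb (φ : U → Fin M → Fin n) (ρ : R → Fin n) (f : U → Fin M) : U ⊕ R → Fin n :=
  Sum.elim (fun u => φ u (f u)) ρ

/-- its edge set -/
noncomputable def eSet (a b : I → U ⊕ R) (φ : U → Fin M → Fin n) (ρ : R → Fin n)
    (f : U → Fin M) : Finset (Sym2 (Fin n)) :=
  Finset.univ.image (fun i => s(emb φ ρ f (a i), emb φ ρ f (b i)))

/-- a point of the pattern is inside `D` together with the roots -/
def inside (D : Finset U) : U ⊕ R → Prop := Sum.elim (· ∈ D) (fun _ => True)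

/-- number of edges inside `D` and the roots -/
noncomputable def eD (a b : I → U ⊕ R) (D : Finset U) : ℕ :=
  (Finset.univ.filter (fun i => inside D (a i) ∧ inside D (b i))).card

/-- admissible patterns -/
structure Pat (a b : I → U ⊕ R) : Prop where
  ne : ∀ i, a i ≠ b i
  inj : ∀ i j, s(a i, b i) = s(a j, b j) → i = j
  left : ∀ i, (∃ u, a i = Sum.inl u) ∨ (∃ u, b i = Sum.inl u)

/-- admissible partite structures -/
structure Part (φ : U → Fin M → Fin n) (ρ : R → Fin n) : Prop where
  inj : ∀ u i u' i', φ u i = φ u' i' → u = u' ∧ i = i'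
  root : ∀ r r', ρ r = ρ r' → r = r'
  sep : ∀ u i r, φ u i ≠ ρ r

variable {a b : I → U ⊕ R} {φ : U → Fin M → Fin n} {ρ : R → Fin n}

lemma emb_eq (h : Part φ ρ) {f g : U → Fin M} {x y : U ⊕ R}
    (e : emb φ ρ f x = emb φ ρ g y) : x = y ∧ ∀ u, x = Sum.inl u → f u = g u := by
  rcases x with u | r <;> rcases y with v | s
  · simp only [emb, Sum.elim_inl] at e
    obtain ⟨h1, h2⟩ := h.inj _ _ _ _ e
    subst h1
    exact ⟨rfl, fun u' hu' => by rw [← Sum.inl.inj hu']; exact h2⟩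
  · exact (h.sep _ _ _ e).elim
  · exact (h.sep _ _ _ e.symm).elim
  · simp only [emb, Sum.elim_inr] at e
    exact ⟨by rw [h.root _ _ e], fun u' hu' => by simp at hu'⟩

lemma emb_edge (h : Part φ ρ) {f g : U → Fin M} {x y x' y' : U ⊕ R}
    (e : s(emb φ ρ f x, emb φ ρ f y) = s(emb φ ρ g x', emb φ ρ g y')) :
    s(x, y) = s(x', y') ∧ (∀ u, x = Sum.inl u → f u = g u) ∧ (∀ u, y = Sum.inl u → f u = g u) := by
  rw [Sym2.eq_iff] at e
  rcases e with ⟨e1, e2⟩ | ⟨e1, e2⟩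
  · obtain ⟨h1, h2⟩ := emb_eq h e1
    obtain ⟨h3, h4⟩ := emb_eq h e2
    exact ⟨by rw [h1, h3], h2, h4⟩
  · obtain ⟨h1, h2⟩ := emb_eq h e1
    obtain ⟨h3, h4⟩ := emb_eq h e2
    exact ⟨by rw [h1, h3, Sym2.eq_swap], h2, h4⟩

lemma card_eSet (hp : Pat a b) (h : Part φ ρ) (f : U → Fin M) :
    (eSet a b φ ρ f).card = Fintype.card I := by
  rw [eSet, Finset.card_image_of_injective, Finset.card_univ]
  intro i j hij
  exact hp.inj i j (emb_edge h hij).1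

lemma eSet_subset (hp : Pat a b) (h : Part φ ρ) (f : U → Fin M) :
    eSet a b φ ρ f ⊆ allE n := by
  intro e he
  simp only [eSet, Finset.mem_image, Finset.mem_univ, true_and] at he
  obtain ⟨i, rfl⟩ := he
  rw [mem_allE, Sym2.mk_isDiag_iff]
  exact fun e => hp.ne i (emb_eq h e).1

lemma card_inter (h : Part φ ρ) (f g : U → Fin M) :
    (eSet a b φ ρ f ∩ eSet a b φ ρ g).card ≤
      eD a b (Finset.univ.filter (fun u => f u = g u)) := by
  rw [eD]
  refine le_trans (Finset.card_le_card ?_) (Finset.card_image_le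
    (f := fun i => s(emb φ ρ f (a i), emb φ ρ f (b i))))
  intro e he
  simp only [eSet, Finset.mem_inter, Finset.mem_image, Finset.mem_univ, true_and] at he
  obtain ⟨⟨i, rfl⟩, j, hj⟩ := he
  obtain ⟨h1, h2, h3⟩ := emb_edge h hj.symm
  refine Finset.mem_image.2 ⟨i, ?_, rfl⟩
  simp only [Finset.mem_filter, Finset.mem_univ, true_and]
  constructor
  · rcases hx : a i with u | r
    · simp [inside, h2 u hx]
    · simp [inside]
  · rcases hx : b i with u | r
    · simp [inside, h3 u hx]
    · simp [inside]

lemma count_agree (D : Finset U) :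
    (Finset.univ.filter (fun x : (U → Fin M) × (U → Fin M) =>
      Finset.univ.filter (fun u => x.1 u = x.2 u) = D)).card * M ^ D.card
      ≤ M ^ (2 * Fintype.card U) := by
  have h1 : (Finset.univ.filter (fun x : (U → Fin M) × (U → Fin M) =>
      Finset.univ.filter (fun u => x.1 u = x.2 u) = D)).card ≤
      Fintype.card ((U → Fin M) × ({u // u ∉ D} → Fin M)) := by
    rw [← Finset.card_univ]
    refine Finset.card_le_card_of_injOn (fun x => (x.1, fun u => x.2 u.1)) (by simp) ?_
    rintro ⟨f, g⟩ hx ⟨f', g'⟩ hy hxy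
    simp only [Prod.mk.injEq] at hxy
    obtain ⟨rfl, h2⟩ := hxy
    simp only [Finset.coe_filter, Finset.mem_univ, true_and, Set.mem_ofPred_eq] at hx hy
    refine Prod.ext rfl (funext fun u => ?_)
    by_cases hu : u ∈ D
    · have e1 := hu
      have e2 := hu
      rw [← hx] at e1
      rw [← hy] at e2
      simp only [Finset.mem_filter, Finset.mem_univ, true_and] at e1 e2
      exact e1.symm.trans e2
    · exact congrFun h2 ⟨u, hu⟩
  have h2 : Fintype.card {u // u ∉ D} = Fintype.card U - D.card := by
    rw [Fintype.card_subtype_compl]; simp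
  simp only [Fintype.card_prod, Fintype.card_fun, Fintype.card_fin, h2] at h1
  have h3 : D.card ≤ Fintype.card U := Finset.card_le_univ D
  calc _ ≤ M ^ Fintype.card U * M ^ (Fintype.card U - D.card) * M ^ D.card :=
        Nat.mul_le_mul_right _ h1
    _ = _ := by rw [mul_assoc, ← pow_add, ← pow_add]; congr 1; omega

lemma eD_le (D : Finset U) : eD a b D ≤ Fintype.card I := Finset.card_le_univ _

lemma eD_empty (hp : Pat a b) : eD a b (∅ : Finset U) = 0 := by
  rw [eD, Finset.card_eq_zero, Finset.filter_eq_empty_iff]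
  rintro i _ ⟨h1, h2⟩
  rcases hp.left i with ⟨u, hu⟩ | ⟨u, hu⟩
  · rw [hu] at h1; simp [inside] at h1
  · rw [hu] at h2; simp [inside] at h2

/-- the second moment bound -/
lemma second_moment (hp : Pat a b) (h : Part φ ρ) {p : ℝ} (h0 : 0 < p) (h1 : p ≤ 1)
    (hM : 0 < M) {K : ℝ} (hK0 : 0 ≤ K) (hK : ∀ D : Finset U, D.Nonempty →
      (1 : ℝ) ≤ K * ((M : ℝ) ^ D.card * p ^ eD a b D)) :
    ∑ f : U → Fin M, ∑ g : U → Fin M, p ^ (eSet a b φ ρ f ∪ eSet a b φ ρ g).card ≤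
      ((M : ℝ) ^ Fintype.card U * p ^ Fintype.card I) ^ 2 * (1 + 2 ^ Fintype.card U * K) := by
  have hM' : (0 : ℝ) < M := by exact_mod_cast hM
  rw [← Fintype.sum_prod_type'
    (fun f g => p ^ (eSet a b φ ρ f ∪ eSet a b φ ρ g).card)]
  set μ := (M : ℝ) ^ Fintype.card U * p ^ Fintype.card I with hμ
  have hμ0 : 0 < μ := by positivity
  rw [← Finset.sum_fiberwise (s := Finset.univ)
    (g := fun x : (U → Fin M) × (U → Fin M) => Finset.univ.filter (fun u => x.1 u = x.2 u))]
  have key : ∀ D : Finset U, ∑ x : (U → Fin M) × (U → Fin M) with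
      Finset.univ.filter (fun u => x.1 u = x.2 u) = D,
        p ^ (eSet a b φ ρ x.1 ∪ eSet a b φ ρ x.2).card ≤
      μ ^ 2 * ((M : ℝ) ^ D.card * p ^ eD a b D)⁻¹ := by
    intro D
    have hb : ∀ x ∈ Finset.univ.filter (fun x : (U → Fin M) × (U → Fin M) =>
        Finset.univ.filter (fun u => x.1 u = x.2 u) = D),
        p ^ (eSet a b φ ρ x.1 ∪ eSet a b φ ρ x.2).card ≤
          p ^ (2 * Fintype.card I - eD a b D) := by
      intro x hx
      refine pow_le_pow_of_le_one h0.le h1 ?_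
      have e1 := card_inter (a := a) (b := b) h x.1 x.2
      rw [(Finset.mem_filter.1 hx).2] at e1
      have e2 := Finset.card_union_add_card_inter (eSet a b φ ρ x.1) (eSet a b φ ρ x.2)
      rw [card_eSet hp h, card_eSet hp h] at e2
      omega
    refine (Finset.sum_le_card_nsmul _ _ _ hb).trans ?_
    rw [nsmul_eq_mul]
    have hc := count_agree (M := M) D
    have hc' : ((Finset.univ.filter (fun x : (U → Fin M) × (U → Fin M) =>
      Finset.univ.filter (fun u => x.1 u = x.2 u) = D)).card : ℝ) * (M : ℝ) ^ D.card
      ≤ (M : ℝ) ^ (2 * Fintype.card U) := by exact_mod_cast hc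
    rw [← div_eq_mul_inv, le_div_iff₀ (by positivity)]
    have e3 : p ^ (2 * Fintype.card I - eD a b D) * p ^ eD a b D = p ^ (2 * Fintype.card I) := by
      rw [← pow_add]; congr 1
      have := eD_le (a := a) (b := b) D
      omega
    calc _ = _ * (M : ℝ) ^ D.card * (p ^ (2 * Fintype.card I - eD a b D) * p ^ eD a b D) := by ring
      _ ≤ (M : ℝ) ^ (2 * Fintype.card U) * p ^ (2 * Fintype.card I) := by
        rw [e3]
        exact mul_le_mul_of_nonneg_right hc' (by positivity)
      _ = μ ^ 2 := by rw [hμ, mul_pow, ← pow_mul, ← pow_mul, mul_comm 2, mul_comm 2]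
  refine (Finset.sum_le_sum fun D _ => key D).trans ?_
  rw [← Finset.mul_sum]
  refine mul_le_mul_of_nonneg_left ?_ (by positivity)
  rw [← Finset.add_sum_erase _ _ (Finset.mem_univ (∅ : Finset U)), eD_empty hp]
  simp only [Finset.card_empty, pow_zero, mul_one, inv_one]
  refine add_le_add_right ?_ 1
  have hb : ∀ D ∈ Finset.univ.erase (∅ : Finset U),
      ((M : ℝ) ^ D.card * p ^ eD a b D)⁻¹ ≤ K := by
    intro D hD
    have := hK D (Finset.nonempty_iff_ne_empty.2 (Finset.ne_of_mem_erase hD))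
    rw [inv_le_iff_one_le_mul₀ (by positivity)]
    exact this
  refine (Finset.sum_le_card_nsmul _ _ _ hb).trans ?_
  rw [nsmul_eq_mul]
  refine mul_le_mul_of_nonneg_right ?_ hK0
  have : (Finset.univ.erase (∅ : Finset U)).card ≤ 2 ^ Fintype.card U := by
    refine (Finset.card_le_univ _).trans ?_
    simp
  exact_mod_cast this

end pattern

end RandomGraphSpectra

namespace RandomGraphSpectra

/-! ## The leg patterns -/

section legs
open Classical

variable {j L : ℕ} {R : Type}

/-- position `t` on leg `i` -/
def pos (e : Fin j → Option (Fin j × Fin L) ⊕ R) (i : Fin j) :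
    ℕ → Option (Fin j × Fin L) ⊕ R
  | 0 => Sum.inl none
  | s + 1 => if h : s < L then Sum.inl (some (i, ⟨s, h⟩)) else e i

/-- first endpoint of an edge -/
def legA (e : Fin j → Option (Fin j × Fin L) ⊕ R) (x : Fin j × Fin (L + 1)) :
    Option (Fin j × Fin L) ⊕ R := pos e x.1 x.2

/-- second endpoint of an edge -/
def legB (e : Fin j → Option (Fin j × Fin L) ⊕ R) (x : Fin j × Fin (L + 1)) :
    Option (Fin j × Fin L) ⊕ R := pos e x.1 (x.2 + 1)

lemma pos_interior (e : Fin j → Option (Fin j × Fin L) ⊕ R) (i : Fin j) (s : Fin L) :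
    pos e i (s + 1) = Sum.inl (some (i, s)) := by
  simp [pos]

lemma pos_end (e : Fin j → Option (Fin j × Fin L) ⊕ R) (i : Fin j) :
    pos e i (L + 1) = e i := by
  simp [pos]

lemma pos_eq {e : Fin j → Option (Fin j × Fin L) ⊕ R} (he : ∀ i q, e i ≠ Sum.inl (some q))
    {i i' : Fin j} {t t' : ℕ} (h1 : 1 ≤ t) (h2 : t ≤ L) (h : pos e i t = pos e i' t') :
    i = i' ∧ t = t' := by
  obtain ⟨s, rfl⟩ : ∃ s, t = s + 1 := ⟨t - 1, by omega⟩
  rw [pos, dif_pos (by omega)] at h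
  rcases t' with _ | s'
  · simp [pos] at h
  · rw [pos] at h
    split_ifs at h with h3
    · simp only [Sum.inl.injEq, Option.some.injEq, Prod.mk.injEq, Fin.mk.injEq] at h
      exact ⟨h.1, by omega⟩
    · exact (he _ _ h.symm).elim

lemma leg_pat (hL : 2 ≤ L) {e : Fin j → Option (Fin j × Fin L) ⊕ R}
    (he : ∀ i q, e i ≠ Sum.inl (some q)) : Pat (legA e) (legB e) := by
  constructor
  · rintro ⟨i, t⟩ h
    simp only [legA, legB] at h
    by_cases ht : 1 ≤ (t : ℕ)
    · have := (pos_eq he ht (by omega) h).2; omega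
    · have := (pos_eq he (by omega) (by omega) h.symm).2; omega
  · rintro ⟨i, t⟩ ⟨i', t'⟩ h
    simp only [legA, legB, Sym2.eq_iff] at h
    have key : i = i' ∧ (t : ℕ) = t' := by
      rcases h with ⟨h1, h2⟩ | ⟨h1, h2⟩
      · by_cases ht : 1 ≤ (t : ℕ)
        · exact pos_eq he ht (by omega) h1
        · have := pos_eq he (by omega) (by omega) h2
          exact ⟨this.1, by omega⟩
      · exfalso
        by_cases ht : 1 ≤ (t : ℕ)
        · have e1 := pos_eq he ht (by omega) h1
          by_cases ht' : 1 ≤ (t' : ℕ)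
          · have e2 := pos_eq he ht' (by omega) h2.symm
            omega
          · have e2 := pos_eq he (by omega) (by omega) h2
            omega
        · have e1 := pos_eq he (by omega) (by omega) h2
          have e2 := pos_eq he (by omega) (by omega) h1.symm
          omega
    exact Prod.ext key.1 (Fin.ext key.2)
  · rintro ⟨i, t⟩
    by_cases ht : 1 ≤ (t : ℕ)
    · left
      refine ⟨some (i, ⟨t - 1, by omega⟩), ?_⟩
      rw [← pos_interior e]
      simp only [legA]; congr 1; omega
    · right
      have ht0 : (t : ℕ) = 0 := by omega
      refine ⟨some (i, ⟨0, by omega⟩), ?_⟩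
      rw [← pos_interior e]
      simp only [legB, ht0]

/-- interior vertices of leg `i` in `D` -/
noncomputable def dL (D : Finset (Option (Fin j × Fin L))) (i : Fin j) : ℕ :=
  (Finset.univ.filter (fun s : Fin L => some (i, s) ∈ D)).card

/-- edges of leg `i` inside `D` -/
noncomputable def eL (e : Fin j → Option (Fin j × Fin L) ⊕ R)
    (D : Finset (Option (Fin j × Fin L))) (i : Fin j) : ℕ :=
  (Finset.univ.filter (fun t : Fin (L + 1) => inside D (pos e i t) ∧
    inside D (pos e i (t + 1)))).card

lemma eD_eq (e : Fin j → Option (Fin j × Fin L) ⊕ R) (D : Finset (Option (Fin j × Fin L))) :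
    eD (legA e) (legB e) D = ∑ i, eL e D i := by
  simp only [eD, eL, Finset.card_filter, Fintype.sum_prod_type]
  rfl

lemma card_D_eq (D : Finset (Option (Fin j × Fin L))) :
    D.card = (if none ∈ D then 1 else 0) + ∑ i, dL D i := by
  have : D.card = ∑ x, if x ∈ D then 1 else 0 := by
    rw [← Finset.card_filter]; simp
  rw [this, Fintype.sum_option, Fintype.sum_prod_type]
  simp only [dL, Finset.card_filter]

lemma eL_le_of_missing {e : Fin j → Option (Fin j × Fin L) ⊕ R}
    {D : Finset (Option (Fin j × Fin L))} {i : Fin j} {s0 : Fin L} (h : some (i, s0) ∉ D) :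
    eL e D i ≤ dL D i := by
  have hL : 0 < L := s0.pos
  refine Finset.card_le_card_of_injOn
    (fun t => if h : (t : ℕ) < s0 then ⟨t, by omega⟩ else ⟨t - 1, by omega⟩) ?_ ?_
  all_goals
    have hin : ∀ t : Fin (L + 1), inside D (pos e i t) ∧ inside D (pos e i (t + 1)) →
      (t : ℕ) ≠ s0 ∧ (t : ℕ) ≠ s0 + 1 := by
      rintro t ⟨h1, h2⟩
      constructor
      · intro ht; rw [ht, pos_interior] at h2; exact h h2
      · intro ht; rw [ht, pos_interior] at h1; exact h h1
  · intro t ht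
    simp only [Finset.coe_filter, Finset.mem_univ, true_and, Set.mem_ofPred_eq] at ht ⊢
    have h3 := hin t ht
    split_ifs with hlt
    · have := ht.2
      rw [pos, dif_pos (by omega)] at this
      exact this
    · have := ht.1
      have e1 : (t : ℕ) = (t - 1 : ℕ) + 1 := by omega
      rw [e1, pos, dif_pos (by omega)] at this
      exact this
  · intro t ht t' ht' heq
    simp only [Finset.coe_filter, Finset.mem_univ, true_and, Set.mem_ofPred_eq] at ht ht'
    have h3 := hin t ht
    have h4 := hin t' ht'
    apply Fin.ext
    dsimp only at heq
    split_ifs at heq <;> simp only [Fin.mk.injEq] at heq <;> omega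

lemma eL_le_of_none {e : Fin j → Option (Fin j × Fin L) ⊕ R}
    {D : Finset (Option (Fin j × Fin L))} {i : Fin j} (hL : 0 < L) (h : none ∉ D) :
    eL e D i ≤ dL D i := by
  have hin : ∀ t : Fin (L + 1), inside D (pos e i t) ∧ inside D (pos e i (t + 1)) →
      (t : ℕ) ≠ 0 := by
    rintro t ⟨h1, h2⟩ ht; rw [ht] at h1; exact h h1
  refine Finset.card_le_card_of_injOn (fun t => ⟨t - 1, by omega⟩) ?_ ?_
  · intro t ht
    simp only [Finset.coe_filter, Finset.mem_univ, true_and, Set.mem_ofPred_eq] at ht ⊢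
    have h3 := hin t ht
    have := ht.1
    have e1 : (t : ℕ) = (t - 1 : ℕ) + 1 := by omega
    rw [e1, pos, dif_pos (by omega)] at this
    exact this
  · intro t ht t' ht' heq
    simp only [Finset.coe_filter, Finset.mem_univ, true_and, Set.mem_ofPred_eq] at ht ht'
    have h3 := hin t ht
    have h4 := hin t' ht'
    apply Fin.ext
    simp only [Fin.mk.injEq] at heq; omega

lemma leg_density {e : Fin j → Option (Fin j × Fin L) ⊕ R} (hL : 0 < L) {α : ℝ} {m : ℕ}
    (hm : 0 < m) (hα0 : 0 < α) (hα1 : α < 1) (hα : (L : ℝ) - α * (L + 1) = - (1 / m))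
    (D : Finset (Option (Fin j × Fin L))) (hD : D.Nonempty) :
    min (1 - (j : ℝ) / m) (1 - α) ≤ D.card - α * eD (legA e) (legB e) D := by
  rw [eD_eq, card_D_eq]
  by_cases hn : none ∈ D
  · refine (min_le_left _ _).trans ?_
    simp only [hn, if_true]
    have key : ∀ i : Fin j, - (1 / (m : ℝ)) ≤ dL D i - α * eL e D i := by
      intro i
      by_cases hall : ∀ s, some (i, s) ∈ D
      · have h1 : dL D i = L := by simp [dL, hall]
        have h2 : eL e D i ≤ L + 1 := by
          refine (Finset.card_le_univ _).trans ?_; simp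
        have h2' : (eL e D i : ℝ) ≤ L + 1 := by exact_mod_cast h2
        rw [h1]; nlinarith
      · push Not at hall
        obtain ⟨s0, hs0⟩ := hall
        have h1 : (eL e D i : ℝ) ≤ dL D i := by exact_mod_cast eL_le_of_missing hs0
        have h3 : (0 : ℝ) ≤ eL e D i := by positivity
        have h4 : (0 : ℝ) ≤ 1 / m := by positivity
        nlinarith
    have := Finset.sum_le_sum (s := Finset.univ) fun i _ => key i
    rw [Finset.sum_sub_distrib, ← Finset.mul_sum] at this
    simp only [Finset.sum_const, Finset.card_univ, Fintype.card_fin, nsmul_eq_mul] at this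
    push_cast
    have e1 : (j : ℝ) / m = j * (1 / m) := by ring
    rw [e1]; linarith
  · refine (min_le_right _ _).trans ?_
    have hc := card_D_eq D
    simp only [hn, if_false, zero_add] at hc ⊢
    have hpos : 1 ≤ ∑ i, dL D i := by rw [← hc]; exact Finset.card_pos.2 hD
    have h1 : ∑ i, eL e D i ≤ ∑ i, dL D i :=
      Finset.sum_le_sum fun i _ => eL_le_of_none hL hn
    have h1' : ((∑ i, eL e D i : ℕ) : ℝ) ≤ ((∑ i, dL D i : ℕ) : ℝ) := by exact_mod_cast h1
    have hpos' : (1 : ℝ) ≤ ((∑ i, dL D i : ℕ) : ℝ) := by exact_mod_cast hpos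
    nlinarith

end legs

end RandomGraphSpectra

namespace RandomGraphSpectra

/-! ## Independence over disjoint blocks -/

section blocks
open Classical

lemma ind_forall {τ : Type} [Fintype τ] (P : τ → Prop) : ∏ i, ind (P i) = ind (∀ i, P i) := by
  by_cases h : ∀ i, P i
  · rw [ind_of h]
    exact Finset.prod_eq_one fun i _ => ind_of (h i)
  · rw [ind_of_not h]
    push Not at h
    obtain ⟨i, hi⟩ := h
    exact Finset.prod_eq_zero (Finset.mem_univ i) (ind_of_not hi)

lemma Ex_prod {n : ℕ} {p : ℝ} {τ K : Type} [Fintype τ] [Fintype K] (c : τ → K → ℝ)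
    (S : τ → K → Finset (Sym2 (Fin n))) (hS : ∀ t k, S t k ⊆ allE n)
    (hd : ∀ t t', t ≠ t' → ∀ k k', Disjoint (S t k) (S t' k')) :
    Ex n p (fun G => ∏ t, ∑ k, c t k * ind (S t k ⊆ eF G)) =
      ∏ t, ∑ k, c t k * p ^ (S t k).card := by
  simp only [Finset.prod_univ_sum]
  rw [Ex_sum]
  refine Finset.sum_congr rfl fun q _ => ?_
  simp only [Finset.prod_mul_distrib, ind_forall]
  rw [Ex_mul]
  congr 1
  have h1 : ∀ G : SimpleGraph (Fin n), (∀ t, S t (q t) ⊆ eF G) ↔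
      Finset.univ.biUnion (fun t => S t (q t)) ⊆ eF G := by
    intro G
    rw [Finset.biUnion_subset]; simp
  simp only [h1]
  rw [Ex_inc p _ (Finset.biUnion_subset.2 fun t _ => hS t _), Finset.card_biUnion, 
    Finset.prod_pow_eq_pow_sum]
  intro t _ t' _ htt'
  exact hd t t' htt' _ _

variable {U R I : Type} [Fintype U] [Fintype I] {n M : ℕ} {a b : I → U ⊕ R} {ρ : R → Fin n}

/-- probability that every block fails -/
lemma block_fail (hp : Pat a b) {T : ℕ} {φ : Fin T → U → Fin M → Fin n}
    (h : ∀ t, Part (φ t) ρ) (hb : ∀ t t' u i u' i', φ t u i = φ t' u' i' → t = t')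
    {p : ℝ} (h0 : 0 < p) (h1 : p ≤ 1)
    (hM : 0 < M) {K : ℝ} (hK0 : 0 ≤ K) (hK : ∀ D : Finset U, D.Nonempty →
      (1 : ℝ) ≤ K * ((M : ℝ) ^ D.card * p ^ eD a b D)) :
    Ex n p (fun G => ind (∀ t f, ¬ eSet a b (φ t) ρ f ⊆ eF G)) ≤
      (2 ^ Fintype.card U * K) ^ T := by
  have hM' : (0 : ℝ) < M := by exact_mod_cast hM
  set μ := (M : ℝ) ^ Fintype.card U * p ^ Fintype.card I with hμ
  have hμ0 : 0 < μ := by positivity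
  let S0 : Fin T → Option (U → Fin M) → Finset (Sym2 (Fin n)) :=
    fun t o => o.elim ∅ (fun f => eSet a b (φ t) ρ f)
  let c0 : Option (U → Fin M) → ℝ := fun o => o.elim (-μ) (fun _ => 1)
  have hS0 : ∀ t o, S0 t o ⊆ allE n := by
    intro t o
    rcases o with _ | f
    · simp [S0]
    · exact eSet_subset hp (h t) f
  have hdisj : ∀ t t', t ≠ t' → ∀ o o', Disjoint (S0 t o) (S0 t' o') := by
    intro t t' htt' o o'
    rcases o with _ | f
    · simp [S0]
    rcases o' with _ | g
    · simp [S0]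
    simp only [S0, Option.elim]
    rw [Finset.disjoint_left]
    intro e he he'
    simp only [eSet, Finset.mem_image, Finset.mem_univ, true_and] at he he'
    obtain ⟨i, rfl⟩ := he
    obtain ⟨i', hi'⟩ := he'
    have aux : ∀ u y, emb (φ t') ρ g y ≠ emb (φ t) ρ f (Sum.inl u) := by
      intro u y hy
      rcases y with v | r
      · exact htt' (hb _ _ _ _ _ _ hy).symm
      · exact (h t).sep _ _ _ hy.symm
    rw [Sym2.eq_iff] at hi'
    rcases hp.left i with ⟨u, hu⟩ | ⟨u, hu⟩ <;> rw [hu] at hi' <;>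
      rcases hi' with ⟨e1, e2⟩ | ⟨e1, e2⟩
    · exact aux _ _ e1
    · exact aux _ _ e2
    · exact aux _ _ e2
    · exact aux _ _ e1
  have key := Ex_prod (p := p) (τ := Fin T) (K := Option (U → Fin M) × Option (U → Fin M))
    (fun _ k => c0 k.1 * c0 k.2) (fun t k => S0 t k.1 ∪ S0 t k.2)
    (fun t k => Finset.union_subset (hS0 _ _) (hS0 _ _))
    (fun t t' htt' k k' => by
      rw [Finset.disjoint_union_left, Finset.disjoint_union_right, Finset.disjoint_union_right]
      exact ⟨⟨hdisj _ _ htt' _ _, hdisj _ _ htt' _ _⟩, ⟨hdisj _ _ htt' _ _, hdisj _ _ htt' _ _⟩⟩)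
  have hsq : ∀ (G : SimpleGraph (Fin n)) t,
      ∑ k : Option (U → Fin M) × Option (U → Fin M), c0 k.1 * c0 k.2 *
        ind (S0 t k.1 ∪ S0 t k.2 ⊆ eF G) =
      (-μ + ∑ f, ind (eSet a b (φ t) ρ f ⊆ eF G)) ^ 2 := by
    intro G t
    have e1 : -μ + ∑ f, ind (eSet a b (φ t) ρ f ⊆ eF G) =
        ∑ o, c0 o * ind (S0 t o ⊆ eF G) := by
      rw [Fintype.sum_option]
      simp [c0, S0, ind_of]
    rw [e1, sq, Finset.sum_mul_sum, Fintype.sum_prod_type]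
    refine Finset.sum_congr rfl fun o _ => Finset.sum_congr rfl fun o' _ => ?_
    rw [Finset.union_subset_iff, ind_and]; ring
  simp only [hsq] at key
  have hval : ∀ t, ∑ k : Option (U → Fin M) × Option (U → Fin M), c0 k.1 * c0 k.2 *
        p ^ (S0 t k.1 ∪ S0 t k.2).card ≤ μ ^ 2 * (2 ^ Fintype.card U * K) := by
    intro t
    have sm := second_moment hp (h t) h0 h1 hM hK0 hK
    rw [← hμ] at sm
    have hcard : (Fintype.card (U → Fin M) : ℝ) * p ^ Fintype.card I = μ := by
      rw [hμ]; simp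
    rw [Fintype.sum_prod_type]
    simp only [Fintype.sum_option, c0, S0, Option.elim, Finset.union_empty, Finset.empty_union,
      Finset.card_empty, pow_zero, card_eSet hp (h t), Finset.sum_const, Finset.card_univ,
      nsmul_eq_mul, Finset.sum_add_distrib, one_mul, mul_one]
    nlinarith [sm, hcard]
  have hlow : Ex n p (fun G => (μ ^ 2) ^ T * ind (∀ t f, ¬ eSet a b (φ t) ρ f ⊆ eF G)) ≤
      (μ ^ 2 * (2 ^ Fintype.card U * K)) ^ T := by
    refine le_trans (Ex_mono h0.le h1 (g := fun G => ∏ t : Fin T,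
      (-μ + ∑ f, ind (eSet a b (φ t) ρ f ⊆ eF G)) ^ 2) ?_) ?_
    · intro G
      by_cases hG : ∀ t f, ¬ eSet a b (φ t) ρ f ⊆ eF G
      · rw [ind_of hG, mul_one]
        simp [ind_of_not (hG _ _)]
      · rw [ind_of_not hG, mul_zero]
        exact Finset.prod_nonneg fun t _ => sq_nonneg _
    · rw [key]
      refine (Finset.prod_le_prod (fun t _ => ?_) fun t _ => hval t).trans (by simp)
      have hs : Ex n p (fun G => ∑ k : Option (U → Fin M) × Option (U → Fin M),
          c0 k.1 * c0 k.2 * ind (S0 t k.1 ∪ S0 t k.2 ⊆ eF G)) = 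
          ∑ k : Option (U → Fin M) × Option (U → Fin M), c0 k.1 * c0 k.2 *
            p ^ (S0 t k.1 ∪ S0 t k.2).card := by
        rw [Ex_sum]
        refine Finset.sum_congr rfl fun k _ => ?_
        rw [Ex_mul, Ex_inc p _ (Finset.union_subset (hS0 _ _) (hS0 _ _))]
      rw [← hs]
      refine Ex_nonneg h0.le h1 fun G => ?_
      rw [hsq]; exact sq_nonneg _
  rw [Ex_mul, mul_pow (μ ^ 2)] at hlow
  exact le_of_mul_le_mul_left hlow (by positivity)

/-- density condition in terms of exponents -/
lemma K_bound (a b : I → U ⊕ R) {α δ κ : ℝ} (hκ0 : 0 < κ) (hκ1 : κ ≤ 1) (hn : 1 ≤ n)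
    (hM : κ * n ≤ M)
    (hδ : ∀ D : Finset U, D.Nonempty → δ ≤ D.card - α * eD a b D) (D : Finset U)
    (hD : D.Nonempty) :
    (1 : ℝ) ≤ ((κ ^ Fintype.card U)⁻¹ * (n : ℝ) ^ (-δ)) *
      ((M : ℝ) ^ D.card * ((n : ℝ) ^ (-α)) ^ eD a b D) := by
  have hn1 : (1 : ℝ) ≤ n := by exact_mod_cast hn
  have hn0 : (0 : ℝ) < n := by linarith
  have h1 : κ ^ Fintype.card U * (n : ℝ) ^ δ ≤
      (M : ℝ) ^ D.card * ((n : ℝ) ^ (-α)) ^ eD a b D := by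
    calc κ ^ Fintype.card U * (n : ℝ) ^ δ ≤ κ ^ D.card * (n : ℝ) ^ ((D.card : ℝ) - α * eD a b D) := by
          refine mul_le_mul (pow_le_pow_of_le_one hκ0.le hκ1 (Finset.card_le_univ D))
            (Real.rpow_le_rpow_of_exponent_le hn1 (hδ D hD)) (by positivity) (by positivity)
      _ = (κ * n) ^ D.card * ((n : ℝ) ^ (-α)) ^ eD a b D := by
          rw [sub_eq_add_neg, Real.rpow_add hn0, Real.rpow_natCast, ← Real.rpow_natCast ((n : ℝ) ^ (-α)),
            ← Real.rpow_mul hn0.le, mul_pow, neg_mul]; ring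
      _ ≤ _ := by gcongr
  calc (1 : ℝ) = ((κ ^ Fintype.card U)⁻¹ * (n : ℝ) ^ (-δ)) * (κ ^ Fintype.card U * (n : ℝ) ^ δ) := by
        rw [Real.rpow_neg hn0.le]
        have : (n : ℝ) ^ δ ≠ 0 := by positivity
        field_simp
    _ ≤ _ := mul_le_mul_of_nonneg_left h1 (by positivity)

end blocks

end RandomGraphSpectra

namespace RandomGraphSpectra

/-! ## The extension property -/

section ext
open Classical

/-- all `j`-tuples have a common `N`-neighbour in the graph without `x` -/
def ExtAt {n : ℕ} (G : SimpleGraph (Fin n)) (N : ℕ) {j : ℕ} (x : Fin n) (ρ : Fin j → Fin n) :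
    Prop := ∃ w, w ≠ x ∧ ∀ i, Near (delG G x) N w (ρ i)

lemma ext_of_eSet {n M j L : ℕ} {G : SimpleGraph (Fin n)} {x : Fin n}
    {φ : Option (Fin j × Fin L) → Fin M → Fin n} {ρ : Fin j → Fin n}
    (hx : ∀ u i, φ u i ≠ x) (hx' : ∀ i, ρ i ≠ x) (f : Option (Fin j × Fin L) → Fin M)
    (h : eSet (legA (fun i => Sum.inr i)) (legB (fun i => Sum.inr i)) φ ρ f ⊆ eF G) :
    ExtAt G (L + 1) x ρ := by
  have hne : ∀ y, emb φ ρ f y ≠ x := by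
    intro y
    rcases y with u | r
    · exact hx _ _
    · exact hx' _
  have hstep : ∀ i t, t ≤ L + 1 → Near (delG G x) t (φ none (f none))
      (emb φ ρ f (pos (fun i => Sum.inr i) i t)) := by
    intro i t
    induction t with
    | zero => intro _; rw [near_zero]; rfl
    | succ t ih =>
      intro ht
      rw [near_add]
      refine ⟨_, ih (by omega), ?_⟩
      rw [near_one]
      right
      refine ⟨?_, hne _, hne _⟩
      have : s(emb φ ρ f (pos (fun i => Sum.inr i) i t),
          emb φ ρ f (pos (fun i => Sum.inr i) i (t + 1))) ∈ eF G := by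
        apply h
        simp only [eSet, Finset.mem_image, Finset.mem_univ, true_and]
        exact ⟨(i, ⟨t, by omega⟩), rfl⟩
      rw [mem_eF] at this
      exact this
  refine ⟨φ none (f none), hx _ _, fun i => ?_⟩
  have := hstep i (L + 1) le_rfl
  rwa [pos_end] at this

/-- existence of blocks -/
lemma exists_blocks {n M T j : ℕ} {U : Type} [Fintype U] (x : Fin n) (ρ : Fin j → Fin n)
    (hc : T * (Fintype.card U * M) + (j + 1) ≤ n) :
    ∃ φ : Fin T → U → Fin M → Fin n, (∀ t u i t' u' i', φ t u i = φ t' u' i' →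
      t = t' ∧ u = u' ∧ i = i') ∧ (∀ t u i, φ t u i ≠ x) ∧ ∀ t u i r, φ t u i ≠ ρ r := by
  let A : Finset (Fin n) := insert x (Finset.univ.image ρ)
  have hA : A.card ≤ j + 1 := by
    refine (Finset.card_insert_le _ _).trans ?_
    have := Finset.card_image_le (s := Finset.univ) (f := ρ)
    simp at this
    omega
  have hcard : Fintype.card (Fin T × U × Fin M) ≤ Fintype.card {v : Fin n // v ∉ A} := by
    rw [Fintype.card_subtype_compl]
    simp
    omega
  obtain ⟨g⟩ := Function.Embedding.nonempty_of_card_le hcard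
  refine ⟨fun t u i => (g (t, u, i)).1, ?_, ?_, ?_⟩
  · intro t u i t' u' i' h
    have := g.injective (Subtype.ext h)
    simpa using this
  · intro t u i h
    exact (g (t, u, i)).2 (by simp [A, h])
  · intro t u i r h
    exact (g (t, u, i)).2 (by simp [A, h])

lemma size_lemma (c r : ℕ) (hc : 0 < c) : ∃ κ : ℝ, 0 < κ ∧ κ ≤ 1 ∧ ∀ᶠ n : ℕ in atTop,
    ∃ M : ℕ, 0 < M ∧ κ * n ≤ M ∧ c * M + r ≤ n := by
  refine ⟨1 / (4 * c), by positivity, ?_, ?_⟩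
  · rw [div_le_one (by positivity)]
    have : (1 : ℝ) ≤ c := by exact_mod_cast hc
    linarith
  · filter_upwards [eventually_ge_atTop (4 * c + 2 * r)] with n hn
    have h1 := Nat.div_add_mod n (2 * c)
    have h2 := Nat.mod_lt n (show 0 < 2 * c by omega)
    refine ⟨n / (2 * c), Nat.div_pos (by omega) (by omega), ?_, ?_⟩
    · have h3 : n ≤ 4 * c * (n / (2 * c)) := by nlinarith
      rw [div_mul_eq_mul_div, one_mul, div_le_iff₀ (by positivity)]
      have : (n : ℝ) ≤ 4 * c * ((n / (2 * c) : ℕ) : ℝ) := by exact_mod_cast h3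
      linarith
    · nlinarith [Nat.zero_le (n % (2 * c))]

lemma ext_prob {L m j : ℕ} (hL : 2 ≤ L) (hm : 0 < m) (hj : j < m) {α : ℝ} (hα0 : 0 < α)
    (hα1 : α < 1) (hα : (L : ℝ) - α * (L + 1) = - (1 / m)) {η : ℝ} (hη : 0 < η) :
    ∀ᶠ n : ℕ in atTop, Ex n ((n : ℝ) ^ (-α)) (fun G => ind (∃ (x : Fin n) (ρ : Fin j → Fin n),
      Function.Injective ρ ∧ (∀ i, ρ i ≠ x) ∧ ¬ ExtAt G (L + 1) x ρ)) ≤ η := by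
  set δ := min (1 - (j : ℝ) / m) (1 - α) with hδ
  have hδ0 : 0 < δ := by
    rw [hδ, lt_min_iff]
    constructor
    · have : (j : ℝ) / m < 1 := by
        rw [div_lt_one (by positivity)]; exact_mod_cast hj
      linarith
    · linarith
  obtain ⟨T, hT⟩ := exists_nat_gt ((j + 2) / δ)
  have hT' : (j + 2 : ℝ) < δ * T := by
    rwa [div_lt_iff₀ hδ0, mul_comm] at hT
  have hT0 : 0 < T := by
    rcases Nat.eq_zero_or_pos T with h | h
    · exfalso; rw [h] at hT'; simp at hT'; linarith [(Nat.cast_nonneg j : (0:ℝ) ≤ j)]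
    · exact h
  set U := Option (Fin j × Fin L) with hU
  have hUc : 0 < Fintype.card U := Fintype.card_pos
  obtain ⟨κ, hκ0, hκ1, hev⟩ := size_lemma (T * Fintype.card U) (j + 1) (by positivity)
  set C : ℝ := (2 ^ Fintype.card U * (κ ^ Fintype.card U)⁻¹) ^ T with hC
  have hC0 : 0 < C := by positivity
  have hlim : Tendsto (fun n : ℕ => C * (n : ℝ) ^ (-(1 : ℝ))) atTop (𝓝 0) := by
    simpa using (tendsto_p (α := 1) one_pos).const_mul C
  filter_upwards [hev, eventually_ge_atTop 1, hlim.eventually (ge_mem_nhds hη)] with n hn hn1 hsmall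
  obtain ⟨M, hM0, hM, hMc⟩ := hn
  have hn1' : (1 : ℝ) ≤ n := by exact_mod_cast hn1
  have hn0 : (0 : ℝ) < n := by linarith
  have hp0 : 0 < (n : ℝ) ^ (-α) := by positivity
  have hp1 : (n : ℝ) ^ (-α) ≤ 1 := Real.rpow_le_one_of_one_le_of_nonpos hn1' (by linarith)
  set e : Fin j → U ⊕ Fin j := fun i => Sum.inr i with he
  have hpat : Pat (legA e) (legB e) := leg_pat hL (by intro i q; simp [he])
  have hK := K_bound (legA e) (legB e) hκ0 hκ1 hn1 hM
    (fun D hD => leg_density (by omega) hm hα0 hα1 hα D hD)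
  rw [← hδ] at hK
  have hone : ∀ (x : Fin n) (ρ : Fin j → Fin n),
      Ex n ((n : ℝ) ^ (-α)) (fun G => ind (Function.Injective ρ ∧ (∀ i, ρ i ≠ x) ∧
        ¬ ExtAt G (L + 1) x ρ)) ≤ C * (n : ℝ) ^ (-(j + 2 : ℝ)) := by
    intro x ρ
    have hrhs : (2 ^ Fintype.card U * ((κ ^ Fintype.card U)⁻¹ * (n : ℝ) ^ (-δ))) ^ T ≤
        C * (n : ℝ) ^ (-(j + 2 : ℝ)) := by
      rw [← mul_assoc, mul_pow, hC]
      refine mul_le_mul_of_nonneg_left ?_ (by positivity)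
      rw [← Real.rpow_natCast, ← Real.rpow_mul hn0.le]
      exact Real.rpow_le_rpow_of_exponent_le hn1' (by linarith)
    by_cases hρ : Function.Injective ρ ∧ (∀ i, ρ i ≠ x)
    · obtain ⟨φ, hφ1, hφ2, hφ3⟩ := exists_blocks (T := T) (M := M) (U := U) x ρ
        (by rw [← mul_assoc]; exact hMc)
      have hb := block_fail (n := n) (ρ := ρ) (φ := φ) hpat
        (fun t => ⟨fun u i u' i' h => (hφ1 _ _ _ _ _ _ h).2, fun r r' h => hρ.1 h,
          fun u i r => hφ3 t u i r⟩)
        (fun t t' u i u' i' h => (hφ1 _ _ _ _ _ _ h).1) hp0 hp1 hM0 (by positivity) hK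
      refine le_trans (Ex_mono hp0.le hp1 fun G => ind_mono ?_) (hb.trans hrhs)
      rintro ⟨_, _, h3⟩ t f hf
      exact h3 (ext_of_eSet (fun u i => hφ2 t u i) hρ.2 f hf)
    · have : Ex n ((n : ℝ) ^ (-α)) (fun G => ind (Function.Injective ρ ∧ (∀ i, ρ i ≠ x) ∧
        ¬ ExtAt G (L + 1) x ρ)) = 0 := by
        rw [Ex]
        refine Finset.sum_eq_zero fun G _ => ?_
        rw [ind_of_not, mul_zero]
        tauto
      rw [this]; positivity
  have hunion : Ex n ((n : ℝ) ^ (-α)) (fun G => ind (∃ (x : Fin n) (ρ : Fin j → Fin n),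
      Function.Injective ρ ∧ (∀ i, ρ i ≠ x) ∧ ¬ ExtAt G (L + 1) x ρ)) ≤
      ∑ y : Fin n × (Fin j → Fin n), Ex n ((n : ℝ) ^ (-α)) (fun G =>
        ind (Function.Injective y.2 ∧ (∀ i, y.2 i ≠ y.1) ∧ ¬ ExtAt G (L + 1) y.1 y.2)) := by
    rw [← Ex_sum]
    refine Ex_mono hp0.le hp1 fun G => ?_
    by_cases h : ∃ (x : Fin n) (ρ : Fin j → Fin n),
      Function.Injective ρ ∧ (∀ i, ρ i ≠ x) ∧ ¬ ExtAt G (L + 1) x ρ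
    · obtain ⟨x, ρ, h'⟩ := h
      refine le_trans ?_ (Finset.single_le_sum (f := fun y : Fin n × (Fin j → Fin n) =>
        ind (Function.Injective y.2 ∧ (∀ i, y.2 i ≠ y.1) ∧ ¬ ExtAt G (L + 1) y.1 y.2))
        (fun _ _ => ind_nonneg _) (Finset.mem_univ (x, ρ)))
      simp only
      rw [ind_of h']
      exact ind_le_one _
    · rw [ind_of_not h]
      exact Finset.sum_nonneg fun _ _ => ind_nonneg _
  refine hunion.trans ((Finset.sum_le_sum fun y _ => hone y.1 y.2).trans ?_)
  refine le_trans (le_of_eq ?_) hsmall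
  rw [Finset.sum_const, Finset.card_univ, nsmul_eq_mul]
  simp only [Fintype.card_prod, Fintype.card_fun, Fintype.card_fin]
  push_cast
  rw [← pow_succ', ← Real.rpow_natCast, mul_left_comm, ← Real.rpow_add hn0]
  congr 2
  push_cast
  ring

end ext

end RandomGraphSpectra

namespace RandomGraphSpectra

/-! ## Deterministic counting -/

section det
open Classical

variable {V : Type} [DecidableEq V] {G : SimpleGraph V}

/-- growing a configuration along a walk -/
lemma grow {u v : V} (p : G.Walk u v) (V0 : Finset V) (E0 : Finset (Sym2 V)) (hu : u ∈ V0)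
    (hE : ∀ e ∈ E0, ∀ z ∈ e, z ∈ V0) :
    (V0 ∪ p.support.toFinset).card + E0.card ≤ (E0 ∪ p.edges.toFinset).card + V0.card := by
  induction p generalizing V0 E0 with
  | nil => simp [hu]; omega
  | @cons u w v h p ih =>
    have hsup : V0 ∪ (SimpleGraph.Walk.cons h p).support.toFinset =
        insert w V0 ∪ p.support.toFinset := by
      ext z
      simp only [SimpleGraph.Walk.support_cons, List.toFinset_cons, Finset.mem_union,
        Finset.mem_insert, List.mem_toFinset]
      have := p.start_mem_support
      constructor
      · rintro (h1 | rfl | h1) <;> tauto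
      · rintro ((rfl | h1) | h1) <;> tauto
    have hed : E0 ∪ (SimpleGraph.Walk.cons h p).edges.toFinset =
        insert s(u, w) E0 ∪ p.edges.toFinset := by
      ext z
      simp only [SimpleGraph.Walk.edges_cons, List.toFinset_cons, Finset.mem_union,
        Finset.mem_insert, List.mem_toFinset]
      tauto
    have := ih (insert w V0) (insert s(u, w) E0) (Finset.mem_insert_self _ _) (by
      intro e he z hz
      rw [Finset.mem_insert] at he ⊢
      rcases he with rfl | he
      · rw [Sym2.mem_iff] at hz
        rcases hz with rfl | rfl
        · exact Or.inr hu
        · exact Or.inl rfl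
      · exact Or.inr (hE e he z hz))
    rw [hsup, hed]
    have key : (insert w V0).card + E0.card ≤ (insert s(u, w) E0).card + V0.card := by
      by_cases hw : w ∈ V0
      · rw [Finset.insert_eq_of_mem hw]
        have := Finset.card_le_card (Finset.subset_insert s(u, w) E0)
        omega
      · have : s(u, w) ∉ E0 := fun h' => hw (hE _ h' w (Sym2.mem_mk_right _ _))
        rw [Finset.card_insert_of_notMem hw, Finset.card_insert_of_notMem this]
        omega
    omega

/-- growing along a trail returning to the configuration -/
lemma grow_strict {u v : V} (p : G.Walk u v) (hp : p.IsTrail) (V0 : Finset V)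
    (E0 : Finset (Sym2 V)) (hu : u ∈ V0) (hv : v ∈ V0)
    (hE : ∀ e ∈ E0, ∀ z ∈ e, z ∈ V0) (hnew : ∃ e ∈ p.edges, e ∉ E0) :
    (V0 ∪ p.support.toFinset).card + E0.card + 1 ≤ (E0 ∪ p.edges.toFinset).card + V0.card := by
  induction p with
  | nil => simp at hnew
  | @cons u w v h p ih =>
    rw [SimpleGraph.Walk.isTrail_cons] at hp
    have hsup : V0 ∪ (SimpleGraph.Walk.cons h p).support.toFinset =
        V0 ∪ p.support.toFinset := by
      ext z
      simp only [SimpleGraph.Walk.support_cons, List.toFinset_cons, Finset.mem_union,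
        Finset.mem_insert, List.mem_toFinset]
      constructor
      · rintro (h1 | rfl | h1) <;> tauto
      · rintro (h1 | h1) <;> tauto
    have hed : E0 ∪ (SimpleGraph.Walk.cons h p).edges.toFinset =
        insert s(u, w) (E0 ∪ p.edges.toFinset) := by
      ext z
      simp only [SimpleGraph.Walk.edges_cons, List.toFinset_cons, Finset.mem_union,
        Finset.mem_insert, List.mem_toFinset]
      tauto
    rw [hsup, hed]
    by_cases hin : s(u, w) ∈ E0
    · have hw : w ∈ V0 := hE _ hin w (Sym2.mem_mk_right _ _)
      have := ih hp.1 hw hv (by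
        obtain ⟨e, he, he'⟩ := hnew
        rw [SimpleGraph.Walk.edges_cons, List.mem_cons] at he
        rcases he with rfl | he
        · exact (he' hin).elim
        · exact ⟨e, he, he'⟩)
      have h2 := Finset.card_le_card (Finset.subset_insert s(u, w) (E0 ∪ p.edges.toFinset))
      omega
    · have hg := grow p.reverse V0 E0 hv hE
      simp only [SimpleGraph.Walk.support_reverse, SimpleGraph.Walk.edges_reverse,
        List.toFinset_reverse] at hg
      rw [Finset.card_insert_of_notMem (by
        rw [Finset.mem_union, List.mem_toFinset]
        rintro (h1 | h1)
        · exact hin h1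
        · exact hp.2 h1)]
      omega

/-- a family of walks from a common vertex -/
lemma grow_family {ι : Type} {x : V} {y : ι → V} (q : ∀ i, G.Walk x (y i)) (s : Finset ι) :
    (insert x (s.biUnion fun i => (q i).support.toFinset)).card ≤
      (s.biUnion fun i => (q i).edges.toFinset).card + 1 := by
  induction s using Finset.induction_on with
  | empty => simp
  | insert i s hi ih =>
    have := grow (q i) (insert x (s.biUnion fun i => (q i).support.toFinset))
      (s.biUnion fun i => (q i).edges.toFinset) (Finset.mem_insert_self _ _) (by
        intro e he z hz
        simp only [Finset.mem_biUnion, List.mem_toFinset] at he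
        obtain ⟨j, hj, he⟩ := he
        apply Finset.mem_insert_of_mem
        simp only [Finset.mem_biUnion, List.mem_toFinset]
        exact ⟨j, hj, SimpleGraph.Walk.mem_support_of_mem_edges he hz⟩)
    rw [Finset.biUnion_insert, Finset.biUnion_insert, Finset.union_comm, ← Finset.insert_union,
      Finset.union_comm (List.toFinset _)]
    omega

lemma near_of_support {D : ℕ} {x b z : V} (q : G.Walk x b) (hq : q.length ≤ D)
    (hz : z ∈ q.support) : Near G D x z :=
  ⟨q.takeUntil z hz, (q.length_takeUntil_le_length hz).trans hq⟩

lemma card_edges_le {u v : V} (q : G.Walk u v) : q.edges.toFinset.card ≤ q.length := by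
  rw [← q.length_edges]; exact List.toFinset_card_le _

lemma alpha_ineq {m N : ℕ} {α : ℝ} (hα1 : α < 1) (hm : 0 < m)
    (hα : (N : ℝ) * (1 - α) = (m - 1) / m) {v e : ℕ} (hv : v + m ≤ e + 1) (he : e ≤ m * N) :
    (v : ℝ) ≤ α * e := by
  have hv' : (v : ℝ) + m ≤ e + 1 := by exact_mod_cast hv
  have he' : (e : ℝ) ≤ m * N := by exact_mod_cast he
  have hm' : (0 : ℝ) < m := by exact_mod_cast hm
  have h1 : (e : ℝ) * (1 - α) ≤ m - 1 := by
    calc (e : ℝ) * (1 - α) ≤ m * N * (1 - α) := mul_le_mul_of_nonneg_right he' (by linarith)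
      _ = m - 1 := by rw [mul_assoc, hα]; field_simp
  linarith

lemma det_small {n : ℕ} {G : SimpleGraph (Fin n)} {m N D : ℕ} (hN : N = 2 * D + 2) {α : ℝ}
    (hα1 : α < 1) (hm : 0 < m) (hα : (N : ℝ) * (1 - α) = (m - 1) / m)
    (good : ∀ H ∈ Bad n α (m * N) ∅ ∅, ¬ H ⊆ eF G) (x : Fin n) (a : Fin m → Fin n)
    (ha : Function.Injective a) (hS : ∀ i, InS G D x (a i)) : False := by
  choose hfar b c hbc hab hac hb hc using hS
  let y : Fin m × Bool → Fin n := fun z => if z.2 then b z.1 else c z.1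
  have hy : ∀ z, Near G D x (y z) := by
    rintro ⟨i, t⟩
    cases t
    · exact hc i
    · exact hb i
  have hay : ∀ z, G.Adj (a z.1) (y z) := by
    rintro ⟨i, t⟩
    cases t
    · exact hac i
    · exact hab i
  have hyinj : ∀ i t t', y (i, t) = y (i, t') → t = t' := by
    intro i t t' h
    cases t <;> cases t' <;> simp [y] at h ⊢
    · exact hbc i h.symm
    · exact hbc i h
  choose q hq using hy
  have hfam := grow_family q Finset.univ
  set VT := insert x (Finset.univ.biUnion fun z => (q z).support.toFinset) with hVT
  set ET := (Finset.univ.biUnion fun z => (q z).edges.toFinset) with hET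
  have hVnear : ∀ v ∈ VT, Near G D x v := by
    intro v hv
    simp only [hVT, Finset.mem_insert, Finset.mem_biUnion, Finset.mem_univ, true_and,
      List.mem_toFinset] at hv
    rcases hv with rfl | ⟨z, hz⟩
    · exact ⟨.nil, by simp⟩
    · exact near_of_support (q z) (hq z) hz
  have hyV : ∀ z, y z ∈ VT := by
    intro z
    simp only [hVT, Finset.mem_insert, Finset.mem_biUnion, Finset.mem_univ, true_and,
      List.mem_toFinset]
    exact Or.inr ⟨z, (q z).end_mem_support⟩
  have haV : ∀ i, a i ∉ VT := fun i h => hfar i (hVnear _ h)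
  have hEV : ∀ e ∈ ET, ∀ v ∈ e, v ∈ VT := by
    intro e he v hv
    simp only [hET, hVT, Finset.mem_insert, Finset.mem_biUnion, Finset.mem_univ, true_and,
      List.mem_toFinset] at he ⊢
    obtain ⟨z, hz⟩ := he
    exact Or.inr ⟨z, SimpleGraph.Walk.mem_support_of_mem_edges hz hv⟩
  let N2 : Finset (Sym2 (Fin n)) := Finset.univ.image (fun z : Fin m × Bool => s(a z.1, y z))
  have hN2 : N2.card = 2 * m := by
    rw [Finset.card_image_of_injective, Finset.card_univ]
    · simp; ring
    · rintro ⟨i, t⟩ ⟨i', t'⟩ h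
      simp only [Sym2.eq_iff] at h
      rcases h with ⟨h1, h2⟩ | ⟨h1, h2⟩
      · have := ha h1
        subst this
        rw [hyinj _ _ _ h2]
      · exact (haV i (h1 ▸ hyV _)).elim
  have hdis : Disjoint ET N2 := by
    rw [Finset.disjoint_left]
    intro e he he'
    simp only [N2, Finset.mem_image, Finset.mem_univ, true_and] at he'
    obtain ⟨z, rfl⟩ := he'
    exact haV z.1 (hEV _ he _ (Sym2.mem_mk_left _ _))
  have hcard : (ET ∪ N2).card = ET.card + 2 * m := by
    rw [Finset.card_union_of_disjoint hdis, hN2]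
  have hETc : ET.card ≤ (2 * m) * D := by
    have : ET.card ≤ (Finset.univ : Finset (Fin m × Bool)).card * D :=
      Finset.card_biUnion_le_card_mul _ _ _ fun z _ => (card_edges_le _).trans (hq z)
    refine this.trans (le_of_eq ?_)
    rw [Finset.card_univ, Fintype.card_prod, Fintype.card_fin, Fintype.card_bool, mul_comm m 2]
  have hsub : ET ∪ N2 ⊆ eF G := by
    intro e he
    rw [mem_eF]
    rw [Finset.mem_union] at he
    rcases he with he | he
    · simp only [hET, Finset.mem_biUnion, Finset.mem_univ, true_and, List.mem_toFinset] at he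
      obtain ⟨z, hz⟩ := he
      exact (q z).edges_subset_edgeSet hz
    · simp only [N2, Finset.mem_image, Finset.mem_univ, true_and] at he
      obtain ⟨z, rfl⟩ := he
      exact hay z
  have hvc : (vE (ET ∪ N2)).card ≤ VT.card + m := by
    have h1 : vE (ET ∪ N2) ⊆ VT ∪ Finset.univ.image a := by
      intro v hv
      rw [mem_vE] at hv
      obtain ⟨e, he, hve⟩ := hv
      rw [Finset.mem_union] at he ⊢
      rcases he with he | he
      · exact Or.inl (hEV e he v hve)
      · simp only [N2, Finset.mem_image, Finset.mem_univ, true_and] at he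
        obtain ⟨z, rfl⟩ := he
        rw [Sym2.mem_iff] at hve
        rcases hve with rfl | rfl
        · exact Or.inr (Finset.mem_image_of_mem _ (Finset.mem_univ _))
        · exact Or.inl (hyV _)
    refine (Finset.card_le_card h1).trans ((Finset.card_union_le _ _).trans ?_)
    have := Finset.card_image_le (s := Finset.univ) (f := a)
    simp only [Finset.card_univ, Fintype.card_fin] at this
    omega
  refine good (ET ∪ N2) ?_ hsub
  simp only [Bad, Finset.mem_filter, Finset.mem_powerset, Finset.disjoint_empty_left, true_and,
    Finset.sdiff_empty]
  refine ⟨hsub.trans (eF_subset G), ?_, ?_, ?_⟩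
  · rw [← Finset.card_pos]; omega
  · rw [hcard, hN]; nlinarith
  · refine alpha_ineq hα1 hm hα (by omega) ?_
    rw [hcard, hN]; nlinarith

end det

end RandomGraphSpectra

namespace RandomGraphSpectra

/-! ## Bouquets of cycles -/

section bouquet
open Classical

/-- `m` cycles of length `N` through `x` -/
structure Bq {V : Type} (m N : ℕ) (P : Fin m → ℕ → V) (x : V) : Prop where
  start : ∀ i, P i 0 = x
  fin : ∀ i, P i N = x
  inj : ∀ i i' t t', 1 ≤ t → t < N → t' ≤ N → P i t = P i' t' → i = i' ∧ t = t'

lemma chain {V : Type} {G : SimpleGraph V} (Q : ℕ → V) (s l : ℕ)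
    (h : ∀ t, s ≤ t → t < s + l → G.Adj (Q t) (Q (t + 1))) :
    ∃ W : G.Walk (Q s) (Q (s + l)), W.length = l ∧
      (∀ t, s ≤ t → t ≤ s + l → Q t ∈ W.support) ∧
      ∀ e ∈ W.edges, ∃ t, s ≤ t ∧ t < s + l ∧ e = s(Q t, Q (t + 1)) := by
  induction l with
  | zero =>
    refine ⟨.nil, rfl, ?_, ?_⟩
    · intro t h1 h2
      have : t = s := by omega
      simp [this]
    · simp
  | succ l ih =>
    obtain ⟨W, h1, h2, h3⟩ := ih (fun t ht ht' => h t ht (by omega))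
    refine ⟨W.concat (h (s + l) (by omega) (by omega)), ?_, ?_, ?_⟩
    · simp [h1]
    · intro t ht ht'
      rw [SimpleGraph.Walk.support_concat]
      by_cases hc : t ≤ s + l
      · simp [h2 t ht hc]
      · have : t = s + l + 1 := by omega
        simp only [this, List.concat_eq_append, List.mem_append, List.mem_singleton]
        exact Or.inr rfl
    · intro e he
      rw [SimpleGraph.Walk.edges_concat] at he
      simp at he
      rcases he with he | he
      · obtain ⟨t, a, b, c⟩ := h3 e he
        exact ⟨t, a, by omega, c⟩
      · exact ⟨s + l, by omega, by omega, he⟩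

/-- edges of the bouquet -/
noncomputable def bF {n : ℕ} (m N : ℕ) (P : Fin m → ℕ → Fin n) : Finset (Sym2 (Fin n)) :=
  Finset.univ.image (fun z : Fin m × Fin N => s(P z.1 z.2, P z.1 (z.2 + 1)))

/-- vertices of the bouquet -/
noncomputable def bV {n : ℕ} (m N : ℕ) (P : Fin m → ℕ → Fin n) : Finset (Fin n) :=
  Finset.univ.image (fun z : Fin m × Fin (N + 1) => P z.1 z.2)

variable {n m N D : ℕ} {P : Fin m → ℕ → Fin n} {x : Fin n} {G : SimpleGraph (Fin n)} {α : ℝ}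

lemma mem_bF (i : Fin m) (t : ℕ) (ht : t < N) : s(P i t, P i (t + 1)) ∈ bF m N P := by
  simp only [bF, Finset.mem_image, Finset.mem_univ, true_and]
  exact ⟨(i, ⟨t, ht⟩), rfl⟩

lemma mem_bV (i : Fin m) (t : ℕ) (ht : t ≤ N) : P i t ∈ bV m N P := by
  simp only [bV, Finset.mem_image, Finset.mem_univ, true_and]
  exact ⟨(i, ⟨t, by omega⟩), rfl⟩

lemma bF_bV : ∀ e ∈ bF m N P, ∀ z ∈ e, z ∈ bV m N P := by
  intro e he z hz
  simp only [bF, Finset.mem_image, Finset.mem_univ, true_and] at he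
  obtain ⟨⟨i, t⟩, rfl⟩ := he
  rw [Sym2.mem_iff] at hz
  rcases hz with rfl | rfl
  · exact mem_bV _ _ (by omega)
  · exact mem_bV _ _ (by simp only; omega)

lemma bq_adj (hF : bF m N P ⊆ eF G) (i : Fin m) (t : ℕ) (ht : t < N) :
    G.Adj (P i t) (P i (t + 1)) := by
  have := hF (mem_bF i t ht)
  rwa [mem_eF] at this

/-- distance potential on the bouquet -/
lemma bq_potential (hB : Bq m N P x) {u v : Fin n} (p : G.Walk u v)
    (hp : ∀ e ∈ p.edges, e ∈ bF m N P) (d : ℕ)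
    (hu : ∃ i t, t ≤ N ∧ u = P i t ∧ (t ≤ d ∨ N ≤ t + d)) :
    ∃ i t, t ≤ N ∧ v = P i t ∧ (t ≤ d + p.length ∨ N ≤ t + (d + p.length)) := by
  induction p generalizing d with
  | nil => simpa using hu
  | @cons u w v h p ih =>
    have hw : ∃ i t, t ≤ N ∧ w = P i t ∧ (t ≤ d + 1 ∨ N ≤ t + (d + 1)) := by
      obtain ⟨j, s, hs, hus, hd⟩ := hu
      have he := hp s(u, w) (by simp)
      simp only [bF, Finset.mem_image, Finset.mem_univ, true_and] at he
      obtain ⟨⟨i, t⟩, he⟩ := he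
      simp only [Sym2.eq_iff] at he
      rcases he with ⟨h1, h2⟩ | ⟨h1, h2⟩
      · refine ⟨i, t + 1, by omega, h2.symm, ?_⟩
        by_cases ht : 1 ≤ (t : ℕ)
        · have := hB.inj i j t s ht (by omega) hs (h1.trans hus)
          omega
        · omega
      · refine ⟨i, t, by omega, h1.symm, ?_⟩
        by_cases ht : (t : ℕ) + 1 < N
        · have := hB.inj i j (t + 1) s (by omega) ht hs (h2.trans hus)
          omega
        · omega
    have := ih (fun e he => hp e (by simp [he])) (d + 1) hw
    simpa [SimpleGraph.Walk.length_cons, add_assoc, add_comm, add_left_comm] using this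

lemma bq_far (hN : N = 2 * D + 2) (hα1 : α < 1) (hm : 2 ≤ m)
    (hα : (N : ℝ) * (1 - α) = (m - 1) / m) (hB : Bq m N P x)
    (good : ∀ H ∈ Bad n α (m * N) (bV m N P) (bF m N P), ¬ H ⊆ eF G) (i : Fin m) :
    ¬ Near G D x (P i (D + 1)) := by
  rintro ⟨q0, hq0⟩
  set q := q0.bypass with hqdef
  have hq : q.length ≤ D := (q0.length_bypass_le_length).trans hq0
  have htrail : q.IsTrail := q0.bypass_isPath.isTrail
  have hx : x ∈ bV m N P := by
    have := mem_bV (P := P) (N := N) i 0 (by omega)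
    rwa [hB.start] at this
  have hnew : ∃ e ∈ q.edges, e ∉ bF m N P := by
    by_contra hcon
    push Not at hcon
    obtain ⟨j, t, ht, he, hd⟩ := bq_potential hB q hcon 0
      ⟨i, 0, by omega, (hB.start i).symm, Or.inl le_rfl⟩
    have := hB.inj i j (D + 1) t (by omega) (by omega) ht he
    omega
  have hg := grow_strict q htrail (bV m N P) (bF m N P) hx (mem_bV i _ (by omega)) bF_bV hnew
  set H := q.edges.toFinset \ bF m N P with hH
  have hHc : H.card ≤ D := by
    refine (Finset.card_le_card Finset.sdiff_subset).trans ((card_edges_le q).trans hq)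
  have h1 : (bF m N P ∪ q.edges.toFinset).card = (bF m N P).card + H.card := by
    rw [← Finset.union_sdiff_self_eq_union, Finset.card_union_of_disjoint Finset.disjoint_sdiff]
  have h2 : (bV m N P ∪ q.support.toFinset).card =
      (bV m N P).card + (q.support.toFinset \ bV m N P).card := by
    rw [← Finset.union_sdiff_self_eq_union, Finset.card_union_of_disjoint Finset.disjoint_sdiff]
  have h3 : (vE H \ bV m N P).card ≤ (q.support.toFinset \ bV m N P).card := by
    refine Finset.card_le_card (Finset.sdiff_subset_sdiff ?_ le_rfl)
    intro v hv
    rw [mem_vE] at hv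
    obtain ⟨e, he, hve⟩ := hv
    rw [hH, Finset.mem_sdiff, List.mem_toFinset] at he
    rw [List.mem_toFinset]
    exact SimpleGraph.Walk.mem_support_of_mem_edges he.1 hve
  have hsub : H ⊆ eF G := by
    intro e he
    rw [hH, Finset.mem_sdiff, List.mem_toFinset] at he
    rw [mem_eF]
    exact q.edges_subset_edgeSet he.1
  refine good H ?_ hsub
  simp only [Bad, Finset.mem_filter, Finset.mem_powerset]
  refine ⟨hsub.trans (eF_subset G), ?_, Finset.disjoint_sdiff, ?_, ?_⟩
  · obtain ⟨e, he, he'⟩ := hnew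
    exact ⟨e, by rw [hH, Finset.mem_sdiff, List.mem_toFinset]; exact ⟨he, he'⟩⟩
  · nlinarith
  · have hv : (vE H \ bV m N P).card + 1 ≤ H.card := by omega
    have hv' : ((vE H \ bV m N P).card : ℝ) + 1 ≤ H.card := by exact_mod_cast hv
    have hc : (H.card : ℝ) ≤ N := by exact_mod_cast (by omega : H.card ≤ N)
    have h4 : (H.card : ℝ) * (1 - α) ≤ 1 := by
      calc (H.card : ℝ) * (1 - α) ≤ N * (1 - α) := mul_le_mul_of_nonneg_right hc (by linarith)
        _ = (m - 1) / m := hα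
        _ ≤ 1 := by
          rw [div_le_one (by positivity)]; linarith
    linarith

lemma bq_inS (hD : 1 ≤ D) (hN : N = 2 * D + 2) (hα1 : α < 1) (hm : 2 ≤ m)
    (hα : (N : ℝ) * (1 - α) = (m - 1) / m) (hB : Bq m N P x) (hF : bF m N P ⊆ eF G)
    (good : ∀ H ∈ Bad n α (m * N) (bV m N P) (bF m N P), ¬ H ⊆ eF G) (i : Fin m) :
    InS G D x (P i (D + 1)) := by
  refine ⟨bq_far hN hα1 hm hα hB good i, P i D, P i (D + 2), ?_, ?_, ?_, ?_, ?_⟩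
  · intro h
    have := hB.inj _ _ _ _ hD (by omega) (by omega) h
    omega
  · exact (bq_adj hF i D (by omega)).symm
  · exact bq_adj hF i (D + 1) (by omega)
  · obtain ⟨W, h1, _⟩ := chain (G := G) (P i) 0 D (fun t _ ht => bq_adj hF i t (by omega))
    exact ⟨W.copy (hB.start i) (by rw [zero_add]), by simp [h1]⟩
  · obtain ⟨W, h1, _⟩ := chain (G := G) (P i) (D + 2) D (fun t _ ht => bq_adj hF i t (by omega))
    have e : P i (D + 2 + D) = x := by rw [← hB.fin i]; congr 1; omega
    exact ⟨(W.copy rfl e).reverse, by simp [h1]⟩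

lemma bq_noQ (hD : 1 ≤ D) (hN : N = 2 * D + 2) (hα1 : α < 1) (hm : 2 ≤ m)
    (hα : (N : ℝ) * (1 - α) = (m - 1) / m) (hB : Bq m N P x) (hF : bF m N P ⊆ eF G)
    (good : ∀ H ∈ Bad n α (m * N) (bV m N P) (bF m N P), ¬ H ⊆ eF G) (w : Fin n)
    (hw : ∀ i, Near (delG G x) N w (P i (D + 1))) : False := by
  have hne : ∀ i t, 1 ≤ t → t < N → P i t ≠ x := by
    intro i t h1 h2 h
    have := hB.inj i i t 0 h1 h2 (by omega) (h.trans (hB.start i).symm)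
    omega
  have hadj : ∀ i t, 1 ≤ t → t + 1 < N → (delG G x).Adj (P i t) (P i (t + 1)) := by
    intro i t h1 h2
    exact ⟨bq_adj hF i t (by omega), hne i t h1 (by omega), hne i (t + 1) (by omega) h2⟩
  choose q hq using hw
  have hW1 := fun i => chain (G := delG G x) (P i) 1 D (fun t h1 h2 => hadj i t h1 (by omega))
  have hW2 := fun i => chain (G := delG G x) (P i) (D + 1) D
    (fun t h1 h2 => hadj i t (by omega) (by omega))
  choose W1 _ hs1 he1 using hW1
  choose W2 _ hs2 he2 using hW2
  have hcm : ∀ i, P i (1 + D) = P i (D + 1) := fun i => by rw [add_comm]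
  let y : Fin m × Bool → Fin n := fun z => if z.2 then P z.1 1 else P z.1 (D + 1 + D)
  let r : ∀ z : Fin m × Bool, (delG G x).Walk w (y z) := fun z =>
    match z with
    | (i, true) => (q i).append ((W1 i).copy rfl (hcm i)).reverse
    | (i, false) => (q i).append (W2 i)
  have hfam := grow_family r Finset.univ
  set VT := insert w (Finset.univ.biUnion fun z => (r z).support.toFinset) with hVT
  set ET := (Finset.univ.biUnion fun z => (r z).edges.toFinset) with hET
  have hEdel : ∀ e ∈ ET, e ∈ (delG G x).edgeSet := by
    intro e he
    simp only [hET, Finset.mem_biUnion, Finset.mem_univ, true_and, List.mem_toFinset] at he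
    obtain ⟨z, hz⟩ := he
    exact (r z).edges_subset_edgeSet hz
  have hEV : ∀ e ∈ ET, ∀ v ∈ e, v ∈ VT := by
    intro e he v hv
    simp only [hET, hVT, Finset.mem_insert, Finset.mem_biUnion, Finset.mem_univ, true_and,
      List.mem_toFinset] at he ⊢
    obtain ⟨z, hz⟩ := he
    exact Or.inr ⟨z, SimpleGraph.Walk.mem_support_of_mem_edges hz hv⟩
  have hleg : ∀ i t, 1 ≤ t → t < N → P i t ∈ VT := by
    intro i t h1 h2
    simp only [hVT, Finset.mem_insert, Finset.mem_biUnion, Finset.mem_univ, true_and,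
      List.mem_toFinset]
    right
    by_cases ht : t ≤ D + 1
    · refine ⟨(i, true), ?_⟩
      simp only [r, SimpleGraph.Walk.mem_support_append_iff, SimpleGraph.Walk.support_reverse,
        List.mem_reverse, SimpleGraph.Walk.support_copy]
      exact Or.inr (hs1 i t h1 (by omega))
    · refine ⟨(i, false), ?_⟩
      simp only [r, SimpleGraph.Walk.mem_support_append_iff]
      exact Or.inr (hs2 i t (by omega) (by omega))
  set H := ET \ bF m N P with hH
  have hHq : H ⊆ Finset.univ.biUnion (fun i => (q i).edges.toFinset) := by
    intro e he
    rw [hH, Finset.mem_sdiff] at he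
    obtain ⟨he, hnF⟩ := he
    simp only [hET, Finset.mem_biUnion, Finset.mem_univ, true_and, List.mem_toFinset] at he ⊢
    obtain ⟨⟨i, t⟩, hz⟩ := he
    refine ⟨i, ?_⟩
    cases t
    · simp only [r, SimpleGraph.Walk.edges_append, List.mem_append] at hz
      rcases hz with hz | hz
      · exact hz
      · obtain ⟨t, _, h2, rfl⟩ := he2 i e hz
        exact (hnF (mem_bF i t (by omega))).elim
    · simp only [r, SimpleGraph.Walk.edges_append, List.mem_append,
        SimpleGraph.Walk.edges_reverse, List.mem_reverse, SimpleGraph.Walk.edges_copy] at hz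
      rcases hz with hz | hz
      · exact hz
      · obtain ⟨t, _, h2, rfl⟩ := he1 i e hz
        exact (hnF (mem_bF i t (by omega))).elim
  have hHc : H.card ≤ m * N := by
    refine (Finset.card_le_card hHq).trans ?_
    have : (Finset.univ.biUnion (fun i => (q i).edges.toFinset)).card ≤
        (Finset.univ : Finset (Fin m)).card * N :=
      Finset.card_biUnion_le_card_mul _ _ _ fun i _ => (card_edges_le _).trans (hq i)
    simpa using this
  have hEF : (ET ∩ bF m N P).card ≤ m * (N - 2) := by
    have hs : ET ∩ bF m N P ⊆ Finset.univ.image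
        (fun z : Fin m × Fin (N - 2) => s(P z.1 (z.2 + 1), P z.1 (z.2 + 2))) := by
      intro e he
      rw [Finset.mem_inter] at he
      obtain ⟨he, heF⟩ := he
      have hd := hEdel e he
      simp only [bF, Finset.mem_image, Finset.mem_univ, true_and] at heF ⊢
      obtain ⟨⟨i, t⟩, rfl⟩ := heF
      have hd' : (delG G x).Adj (P i t) (P i (t + 1)) := hd
      have ht0 : (t : ℕ) ≠ 0 := by
        intro h; rw [h, hB.start] at hd'; exact hd'.2.1 rfl
      have ht1 : (t : ℕ) + 1 ≠ N := by
        intro h; rw [h, hB.fin] at hd'; exact hd'.2.2 rfl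
      refine ⟨(i, ⟨t - 1, by omega⟩), ?_⟩
      have e1 : (t : ℕ) - 1 + 1 = t := by omega
      have e2 : (t : ℕ) - 1 + 2 = t + 1 := by omega
      simp only [e1, e2]
    refine (Finset.card_le_card hs).trans (Finset.card_image_le.trans ?_)
    simp
  have hVF : m * (N - 1) ≤ (VT ∩ bV m N P).card := by
    have hs : Finset.univ.image (fun z : Fin m × Fin (N - 1) => P z.1 (z.2 + 1)) ⊆
        VT ∩ bV m N P := by
      intro v hv
      simp only [Finset.mem_image, Finset.mem_univ, true_and] at hv
      obtain ⟨⟨i, t⟩, rfl⟩ := hv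
      rw [Finset.mem_inter]
      exact ⟨hleg i _ (by simp only; omega) (by simp only; omega),
        mem_bV i _ (by simp only; omega)⟩
    refine le_trans (le_of_eq ?_) (Finset.card_le_card hs)
    rw [Finset.card_image_of_injective, Finset.card_univ]
    · simp
    · rintro ⟨i, t⟩ ⟨i', t'⟩ h
      have := hB.inj i i' (t + 1) (t' + 1) (by omega) (by omega) (by omega) h
      exact Prod.ext this.1 (Fin.ext (by simp only; omega))
  have h1 : (ET ∩ bF m N P).card + H.card = ET.card := by
    rw [hH]; exact Finset.card_inter_add_card_sdiff _ _
  have h2 : (VT ∩ bV m N P).card + (VT \ bV m N P).card = VT.card :=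
    Finset.card_inter_add_card_sdiff _ _
  have h3 : (vE H \ bV m N P).card ≤ (VT \ bV m N P).card := by
    refine Finset.card_le_card (Finset.sdiff_subset_sdiff ?_ le_rfl)
    intro v hv
    rw [mem_vE] at hv
    obtain ⟨e, he, hve⟩ := hv
    rw [hH, Finset.mem_sdiff] at he
    exact hEV e he.1 v hve
  have h4 : m * (N - 1) = m * (N - 2) + m := by
    have : N - 1 = (N - 2) + 1 := by omega
    rw [this]; ring
  have hmain : (vE H \ bV m N P).card + m ≤ H.card + 1 := by omega
  have hsub : H ⊆ eF G := by
    intro e he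
    rw [hH, Finset.mem_sdiff] at he
    have := hEdel e he.1
    rw [mem_eF]
    have hle : delG G x ≤ G := fun u v h => h.1
    exact SimpleGraph.edgeSet_mono hle this
  refine good H ?_ hsub
  simp only [Bad, Finset.mem_filter, Finset.mem_powerset]
  refine ⟨hsub.trans (eF_subset G), ?_, Finset.disjoint_sdiff, hHc, ?_⟩
  · rw [← Finset.card_pos]; omega
  · exact alpha_ineq hα1 (by omega) hα hmain hHc

lemma bq_notPL (hD : 1 ≤ D) (hN : N = 2 * D + 2) (hα1 : α < 1) (hm : 2 ≤ m)
    (hα : (N : ℝ) * (1 - α) = (m - 1) / m) (hB : Bq m N P x) (hF : bF m N P ⊆ eF G)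
    (good : ∀ H ∈ Bad n α (m * N) (bV m N P) (bF m N P), ¬ H ⊆ eF G) : ¬ PL G N D := by
  intro h
  obtain ⟨w, _, hw⟩ := h x
  exact bq_noQ hD hN hα1 hm hα hB hF good w
    (fun i => hw _ (bq_inS hD hN hα1 hm hα hB hF good i))

end bouquet

end RandomGraphSpectra

namespace RandomGraphSpectra

/-! ## Assembly -/

section assembly
open Classical

lemma PL_of_good {n m L D : ℕ} {G : SimpleGraph (Fin n)} {α : ℝ} (hN : L + 1 = 2 * D + 2)
    (hα1 : α < 1) (hm : 2 ≤ m) (hα : ((L + 1 : ℕ) : ℝ) * (1 - α) = (m - 1) / m) (hn : m ≤ n)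
    (good : ∀ H ∈ Bad n α (m * (L + 1)) ∅ ∅, ¬ H ⊆ eF G)
    (ext : ¬ ∃ (x : Fin n) (ρ : Fin (m - 1) → Fin n), Function.Injective ρ ∧ (∀ i, ρ i ≠ x) ∧
      ¬ ExtAt G (L + 1) x ρ) : PL G (L + 1) D := by
  intro x
  set S : Finset (Fin n) := Finset.univ.filter (fun s => InS G D x s) with hS
  have hSc : S.card ≤ m - 1 := by
    by_contra hcon
    obtain ⟨T, hT, hTc⟩ := Finset.exists_subset_card_eq (show m ≤ S.card by omega)
    refine det_small hN hα1 (by omega) hα good x (fun i => (T.equivFinOfCardEq hTc).symm i) ?_ ?_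
    · intro i j hij
      exact (T.equivFinOfCardEq hTc).symm.injective (Subtype.ext hij)
    · intro i
      have := hT ((T.equivFinOfCardEq hTc).symm i).2
      rw [hS, Finset.mem_filter] at this
      exact this.2
  have hSx : S ⊆ Finset.univ.erase x := by
    intro s hs
    rw [hS, Finset.mem_filter] at hs
    refine Finset.mem_erase.2 ⟨?_, Finset.mem_univ _⟩
    rintro rfl
    exact hs.2.1 ⟨.nil, Nat.zero_le _⟩
  have hcard : (Finset.univ.erase x).card = n - 1 := by
    rw [Finset.card_erase_of_mem (Finset.mem_univ x)]; simp
  obtain ⟨T, hST, hTx, hTc⟩ := Finset.exists_subsuperset_card_eq hSx hSc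
    (show m - 1 ≤ (Finset.univ.erase x).card by omega)
  have h : ExtAt G (L + 1) x (fun i => ((T.equivFinOfCardEq hTc).symm i : Fin n)) := by
    by_contra hcon
    refine ext ⟨x, _, ?_, ?_, hcon⟩
    · intro i j hij
      exact (T.equivFinOfCardEq hTc).symm.injective (Subtype.ext hij)
    · intro i
      exact (Finset.mem_erase.1 (hTx ((T.equivFinOfCardEq hTc).symm i).2)).1
  obtain ⟨w, hw, hw'⟩ := h
  refine ⟨w, hw, fun s hs => ?_⟩
  have hsT : s ∈ T := hST (by rw [hS, Finset.mem_filter]; exact ⟨Finset.mem_univ _, hs⟩)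
  have := hw' (T.equivFinOfCardEq hTc ⟨s, hsT⟩)
  simpa using this

lemma prob_PL {m L D : ℕ} (hN : L + 1 = 2 * D + 2) (hL : 2 ≤ L) (hm : 2 ≤ m) {α : ℝ}
    (hα0 : 0 < α) (hα1 : α < 1) (hα : ((L + 1 : ℕ) : ℝ) * (1 - α) = (m - 1) / m)
    (hα' : (L : ℝ) - α * (L + 1) = - (1 / m)) :
    ∃ c : ℝ, 0 < c ∧ ∀ᶠ n : ℕ in atTop,
      c ≤ Ex n ((n : ℝ) ^ (-α)) (fun G => ind (PL G (L + 1) D)) := by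
  obtain ⟨c, hc, hev⟩ := good_bound hα0 0 (m * (L + 1))
  refine ⟨c / 2, by positivity, ?_⟩
  filter_upwards [hev, ext_prob (j := m - 1) hL (by omega) (by omega) hα0 hα1 hα'
    (show 0 < c / 2 by positivity), eventually_ge_atTop m] with n h1 h2 h3
  have hn1 : (1 : ℝ) ≤ n := by exact_mod_cast (by omega : 1 ≤ n)
  have hp0 : 0 ≤ (n : ℝ) ^ (-α) := by positivity
  have hp1 : (n : ℝ) ^ (-α) ≤ 1 := Real.rpow_le_one_of_one_le_of_nonpos hn1 (by linarith)
  have h4 := h1 ∅ ∅ (by simp) (by simp)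
  rw [Finset.card_empty, pow_zero, mul_one] at h4
  have h5 : Ex n ((n : ℝ) ^ (-α)) (fun G => ind ((∅ : Finset (Sym2 (Fin n))) ⊆ eF G) *
        ind (∀ H ∈ Bad n α (m * (L + 1)) ∅ ∅, ¬ H ⊆ eF G) -
      ind (∃ (x : Fin n) (ρ : Fin (m - 1) → Fin n),
      Function.Injective ρ ∧ (∀ i, ρ i ≠ x) ∧ ¬ ExtAt G (L + 1) x ρ)) ≤
      Ex n ((n : ℝ) ^ (-α)) (fun G => ind (PL G (L + 1) D)) := by
    refine Ex_mono hp0 hp1 fun G => ?_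
    by_cases hg : ∀ H ∈ Bad n α (m * (L + 1)) ∅ ∅, ¬ H ⊆ eF G
    · by_cases he : ∃ (x : Fin n) (ρ : Fin (m - 1) → Fin n),
        Function.Injective ρ ∧ (∀ i, ρ i ≠ x) ∧ ¬ ExtAt G (L + 1) x ρ
      · rw [ind_of he, ind_of hg, ind_of (Finset.empty_subset _)]
        linarith [ind_nonneg (PL G (L + 1) D)]
      · rw [ind_of (PL_of_good hN hα1 hm hα h3 hg he), ind_of hg, ind_of (Finset.empty_subset _)]
        linarith [ind_nonneg (∃ (x : Fin n) (ρ : Fin (m - 1) → Fin n),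
          Function.Injective ρ ∧ (∀ i, ρ i ≠ x) ∧ ¬ ExtAt G (L + 1) x ρ)]
    · rw [ind_of_not hg, mul_zero]
      linarith [ind_nonneg (PL G (L + 1) D), ind_nonneg (∃ (x : Fin n) (ρ : Fin (m - 1) → Fin n),
          Function.Injective ρ ∧ (∀ i, ρ i ≠ x) ∧ ¬ ExtAt G (L + 1) x ρ)]
  rw [Ex_sub] at h5
  linarith

lemma Ex_cs {n : ℕ} {p : ℝ} (h0 : 0 ≤ p) (h1 : p ≤ 1) (X : SimpleGraph (Fin n) → ℝ)
    (P : SimpleGraph (Fin n) → Prop) :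
    (Ex n p (fun G => X G * ind (P G))) ^ 2 ≤
      Ex n p (fun G => X G ^ 2) * Ex n p (fun G => ind (P G)) := by
  unfold Ex
  refine Finset.sum_sq_le_sum_mul_sum_of_sq_le_mul _ ?_ ?_ ?_
  · intro G _; exact mul_nonneg (weight_nonneg h0 h1 G) (sq_nonneg _)
  · intro G _; exact mul_nonneg (weight_nonneg h0 h1 G) (ind_nonneg _)
  · intro G _
    refine le_of_eq ?_
    by_cases h : P G
    · simp only [ind_of h]; ring
    · simp only [ind_of_not h]; ring

lemma Ex_sq_sum {n : ℕ} {p : ℝ} {ι : Type} [Fintype ι] (F : ι → Finset (Sym2 (Fin n)))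
    (hF : ∀ f, F f ⊆ allE n) :
    Ex n p (fun G => (∑ f, ind (F f ⊆ eF G)) ^ 2) = ∑ f, ∑ g, p ^ (F f ∪ F g).card := by
  have : (fun G : SimpleGraph (Fin n) => (∑ f, ind (F f ⊆ eF G)) ^ 2) =
      fun G => ∑ f, ∑ g, ind (F f ∪ F g ⊆ eF G) := by
    funext G
    rw [sq, Finset.sum_mul_sum]
    refine Finset.sum_congr rfl fun f _ => Finset.sum_congr rfl fun g _ => ?_
    rw [← ind_and, Finset.union_subset_iff]
  rw [this, Ex_sum]
  refine Finset.sum_congr rfl fun f _ => ?_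
  rw [Ex_sum]
  refine Finset.sum_congr rfl fun g _ => ?_
  exact Ex_inc p _ (Finset.union_subset (hF f) (hF g))

lemma cs_bound {n : ℕ} {p c C : ℝ} (hp0 : 0 < p) (hp1 : p ≤ 1) (hc : 0 < c) (hC0 : 0 < C)
    {ι : Type} [Fintype ι] [Nonempty ι] (F : ι → Finset (Sym2 (Fin n))) (s : ℕ)
    (hFall : ∀ f, F f ⊆ allE n) (Q : ι → SimpleGraph (Fin n) → Prop)
    (P : SimpleGraph (Fin n) → Prop)
    (hQ : ∀ f, c * p ^ s ≤ Ex n p (fun G => ind (F f ⊆ eF G) * ind (Q f G)))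
    (hP : ∀ f G, F f ⊆ eF G → Q f G → P G)
    (hsm : ∑ f, ∑ g, p ^ (F f ∪ F g).card ≤ ((Fintype.card ι : ℝ) * p ^ s) ^ 2 * C) :
    c ^ 2 / C ≤ Ex n p (fun G => ind (P G)) := by
  have hcard : (0 : ℝ) < Fintype.card ι := by exact_mod_cast Fintype.card_pos
  set μ : ℝ := Fintype.card ι * p ^ s with hμ
  have hμ0 : 0 < μ := by positivity
  have hlow : c * μ ≤ Ex n p (fun G => (∑ f, ind (F f ⊆ eF G)) * ind (P G)) := by
    have hle : Ex n p (fun G => ∑ f, ind (F f ⊆ eF G) * ind (Q f G)) ≤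
        Ex n p (fun G => (∑ f, ind (F f ⊆ eF G)) * ind (P G)) := by
      refine Ex_mono hp0.le hp1 fun G => ?_
      rw [Finset.sum_mul]
      refine Finset.sum_le_sum fun f _ => ?_
      rw [← ind_and, ← ind_and]
      exact ind_mono fun a => ⟨a.1, hP f G a.1 a.2⟩
    refine le_trans ?_ hle
    rw [Ex_sum]
    have hsum : c * μ = ∑ f : ι, c * p ^ s := by
      rw [Finset.sum_const, Finset.card_univ, nsmul_eq_mul, hμ]
      ring
    rw [hsum]
    exact Finset.sum_le_sum fun f _ => hQ f
  have hcs := Ex_cs hp0.le hp1 (fun G => ∑ f, ind (F f ⊆ eF G)) P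
  rw [Ex_sq_sum F hFall] at hcs
  have hq0 : 0 ≤ Ex n p (fun G => ind (P G)) := Ex_nonneg hp0.le hp1 fun G => ind_nonneg _
  have h6 : (c * μ) ^ 2 ≤ μ ^ 2 * C * Ex n p (fun G => ind (P G)) :=
    calc (c * μ) ^ 2 ≤ _ := pow_le_pow_left₀ (by positivity) hlow 2
      _ ≤ _ := hcs
      _ ≤ _ := mul_le_mul_of_nonneg_right hsm hq0
  rw [div_le_iff₀ hC0]
  have h7 : μ ^ 2 * c ^ 2 ≤ μ ^ 2 * (Ex n p (fun G => ind (P G)) * C) := by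
    linarith
  exact le_of_mul_le_mul_left h7 (by positivity)

/-- the bouquet given by an embedding of the leg pattern -/
def bqP {m L M n : ℕ} (φ : Option (Fin m × Fin L) → Fin M → Fin n) (ρ : Fin 0 → Fin n)
    (f : Option (Fin m × Fin L) → Fin M) (i : Fin m) (t : ℕ) : Fin n :=
  emb φ ρ f (pos (fun _ => Sum.inl none) i t)

lemma bqP_eSet {m L M n : ℕ} (φ : Option (Fin m × Fin L) → Fin M → Fin n) (ρ : Fin 0 → Fin n)
    (f : Option (Fin m × Fin L) → Fin M) :
    eSet (legA (fun _ => Sum.inl none)) (legB (fun _ => Sum.inl none)) φ ρ f =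
      bF m (L + 1) (bqP φ ρ f) := rfl

lemma bqP_Bq {m L M n : ℕ} {φ : Option (Fin m × Fin L) → Fin M → Fin n} {ρ : Fin 0 → Fin n}
    (hpart : Part φ ρ) (f : Option (Fin m × Fin L) → Fin M) :
    Bq m (L + 1) (bqP φ ρ f) (φ none (f none)) := by
  refine ⟨fun i => rfl, fun i => ?_, ?_⟩
  · rw [bqP, pos_end]; rfl
  · intro i i' t t' ht1 ht2 _ h
    exact pos_eq (by intro i q; simp) ht1 (by omega) (emb_eq hpart h).1

lemma prob_notPL {m L D : ℕ} (hD : 1 ≤ D) (hN : L + 1 = 2 * D + 2) (hL : 2 ≤ L) (hm : 2 ≤ m)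
    {α : ℝ}
    (hα0 : 0 < α) (hα1 : α < 1) (hα : ((L + 1 : ℕ) : ℝ) * (1 - α) = (m - 1) / m)
    (hα' : (L : ℝ) - α * (L + 1) = - (1 / m)) :
    ∃ c : ℝ, 0 < c ∧ ∀ᶠ n : ℕ in atTop,
      c ≤ Ex n ((n : ℝ) ^ (-α)) (fun G => ind (¬ PL G (L + 1) D)) := by
  obtain ⟨c, hc, hev⟩ := good_bound hα0 (m * (L + 1 + 1)) (m * (L + 1))
  set U := Option (Fin m × Fin L) with hU
  have hUc : 0 < Fintype.card U := Fintype.card_pos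
  obtain ⟨κ, hκ0, hκ1, hev2⟩ := size_lemma (Fintype.card U) 1 hUc
  set C : ℝ := 1 + 2 ^ Fintype.card U * (κ ^ Fintype.card U)⁻¹ with hC
  have hC0 : 0 < C := by positivity
  refine ⟨c ^ 2 / C, by positivity, ?_⟩
  filter_upwards [hev, hev2, eventually_ge_atTop 1] with n h1 h2 hn
  obtain ⟨M, hM0, hM, hMc⟩ := h2
  have hM0' : (0 : ℝ) < M := by exact_mod_cast hM0
  have hn1 : (1 : ℝ) ≤ n := by exact_mod_cast hn
  have hp0 : 0 < (n : ℝ) ^ (-α) := by positivity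
  have hp1 : (n : ℝ) ^ (-α) ≤ 1 := Real.rpow_le_one_of_one_le_of_nonpos hn1 (by linarith)
  obtain ⟨φ, hφ, -, -⟩ := exists_blocks (T := 1) (M := M) (U := U) (j := 0)
    (⟨0, by omega⟩ : Fin n) Fin.elim0 (by omega)
  set ρ : Fin 0 → Fin n := Fin.elim0 with hρ
  have hpart : Part (φ 0) ρ := ⟨fun u i u' i' h => (hφ _ _ _ _ _ _ h).2, fun r => r.elim0,
    fun _ _ r => r.elim0⟩
  set e : Fin m → U ⊕ Fin 0 := fun _ => Sum.inl none with he
  have he' : ∀ i q, e i ≠ Sum.inl (some q) := by intro i q; simp [he]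
  have hpat : Pat (legA e) (legB e) := leg_pat hL he'
  have hK := K_bound (legA e) (legB e) hκ0 hκ1 hn hM
    (fun D hD => leg_density (by omega) (by omega) hα0 hα1 hα' D hD)
  have hmin : min (1 - (m : ℝ) / m) (1 - α) = 0 := by
    rw [div_self (by positivity), sub_self]
    exact min_eq_left (by linarith)
  rw [hmin, neg_zero, Real.rpow_zero, mul_one] at hK
  have hsm := second_moment hpat hpart hp0 hp1 hM0 (by positivity) hK
  rw [← hC] at hsm
  have hne : Nonempty (U → Fin M) := ⟨fun _ => ⟨0, hM0⟩⟩
  refine cs_bound hp0 hp1 hc hC0 (fun f => eSet (legA e) (legB e) (φ 0) ρ f)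
    (Fintype.card (Fin m × Fin (L + 1))) (fun f => eSet_subset hpat hpart f)
    (fun f G => ∀ H ∈ Bad n α (m * (L + 1)) (bV m (L + 1) (bqP (φ 0) ρ f))
      (eSet (legA e) (legB e) (φ 0) ρ f), ¬ H ⊆ eF G) _ ?_ ?_ ?_
  · intro f
    have := h1 (bV m (L + 1) (bqP (φ 0) ρ f)) (eSet (legA e) (legB e) (φ 0) ρ f)
      (Finset.card_image_le.trans (by simp)) (eSet_subset hpat hpart f)
    rwa [card_eSet hpat hpart f] at this
  · intro f G a1 a2
    rw [he, bqP_eSet] at a1 a2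
    exact bq_notPL hD hN hα1 hm hα (bqP_Bq hpart f) a1 a2
  · refine le_trans (le_of_eq ?_) (hsm.trans (le_of_eq ?_))
    · refine Finset.sum_congr (by ext; simp) fun f _ => Finset.sum_congr (by ext; simp) fun g _ => rfl
    rw [Fintype.card_fun, Fintype.card_fin]
    push_cast
    rfl

end assembly

/-- For `k ≥ 8`, `m ≥ 2` and `α = 1 - 1/2^{k-5} + 1/(2^{k-5}·m)`, one has `α ∈ S_k^1`. -/
theorem mem_S1_large_exponent (k m : ℕ) (hk : 8 ≤ k) (hm : 2 ≤ m)
    (α : ℝ)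
    (hα : α = 1 - 1 / (2 : ℝ) ^ (k - 5) + 1 / ((2 : ℝ) ^ (k - 5) * (m : ℝ))) :
    α ∈ S1 k := by
  obtain ⟨q, rfl⟩ : ∃ q, k = q + 6 := ⟨k - 6, by omega⟩
  have hq : 4 ≤ 2 ^ q := by
    calc 4 = 2 ^ 2 := by norm_num
      _ ≤ 2 ^ q := Nat.pow_le_pow_right (by norm_num) (by omega)
  have e5 : q + 6 - 5 = q + 1 := by omega
  have e6 : q + 6 - 6 = q := by omega
  rw [e5] at hα
  obtain ⟨φ, hφ1, hφ2⟩ := exists_sentence (q + 6) hk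
  rw [e5, e6] at hφ2
  obtain ⟨D, hD⟩ : ∃ D, D = 2 ^ q - 1 := ⟨_, rfl⟩
  obtain ⟨L, hL⟩ : ∃ L, L = 2 * D + 1 := ⟨_, rfl⟩
  have hLN : 2 ^ (q + 1) = L + 1 := by rw [pow_succ]; omega
  rw [hLN, ← hD] at hφ2
  have hLR : (2 : ℝ) ^ (q + 1) = L + 1 := by exact_mod_cast hLN
  rw [hLR] at hα
  have hm2 : (2 : ℝ) ≤ m := by exact_mod_cast hm
  have hm0 : (0 : ℝ) < m := by linarith
  have hL1 : (0 : ℝ) < (L : ℝ) + 1 := by positivity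
  have hL2 : (2 : ℝ) ≤ L := by exact_mod_cast (by omega : 2 ≤ L)
  have hα1 : ((L + 1 : ℕ) : ℝ) * (1 - α) = (m - 1) / m := by
    rw [hα]; push_cast; field_simp; ring
  have hα2 : (L : ℝ) - α * (L + 1) = - (1 / m) := by
    rw [hα]; field_simp; ring
  have hlt : α < 1 := by
    have h1 : (0 : ℝ) < (m - 1) / m := div_pos (by linarith) hm0
    rw [← hα1] at h1
    by_contra hcon
    push_cast at h1
    nlinarith
  have hpos : 0 < α := by
    have h1 : 0 < 1 / (m : ℝ) := by positivity
    by_contra hcon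
    have h2 : α * (L + 1) ≤ 0 := mul_nonpos_of_nonpos_of_nonneg (not_lt.1 hcon) hL1.le
    linarith
  obtain ⟨c, hc, hev⟩ := prob_PL (D := D) (by omega) (by omega) hm hpos hlt hα1 hα2
  obtain ⟨c', hc', hev'⟩ := prob_notPL (D := D) (by omega) (by omega) (by omega) hm hpos hlt hα1 hα2
  have hprob : ∀ n : ℕ, probSat n ((n : ℝ) ^ (-α)) φ =
      Ex n ((n : ℝ) ^ (-α)) (fun G => ind (PL G (L + 1) D)) := by
    intro n
    rw [probSat, probPred_eq]
    simp only [hφ2]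
  refine ⟨⟨hpos, hlt⟩, φ, hφ1, ?_⟩
  simp only [hprob]
  rintro (h | h)
  · have := ge_of_tendsto h hev
    linarith
  · have h2 : ∀ᶠ n : ℕ in atTop,
        Ex n ((n : ℝ) ^ (-α)) (fun G => ind (PL G (L + 1) D)) ≤ 1 - c' := by
      filter_upwards [hev'] with n hn
      simp only [ind_not] at hn
      rw [Ex_sub, Ex_one] at hn
      linarith
    have := le_of_tendsto h h2
    linarith

end RandomGraphSpectra
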